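/- Let A be a separable C*-algebra. Every Cuntz-increasing sequence (p_n) of open projections in (A⊗K)** (i.e. p_n ≾ p_{n+1} for all n) admits a supremum of its classes [p_n] in Cu(A). -/

import Mathlib

open Filter Topology

namespace CuntzOP

variable {H : Type*} [NormedAddCommGroup H] [InnerProductSpace ℂ H] [CompleteSpace H]

/-- The Loewner order on bounded operators on a Hilbert space. -/
def opLE (a b : H →L[ℂ] H) : Prop := (b - a).IsPositive

/-- `A` is a (not necessarily unital) norm-closed *-subalgebra of `B(H)`,
i.e. a concrete C*-algebra. -/
def IsCStarSubalg (A : Set (H →L[ℂ] H)) : Prop :=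
  (0 : H →L[ℂ] H) ∈ A ∧ (∀ x ∈ A, ∀ y ∈ A, x + y ∈ A) ∧
    (∀ (c : ℂ), ∀ x ∈ A, c • x ∈ A) ∧ (∀ x ∈ A, ∀ y ∈ A, x * y ∈ A) ∧
    (∀ x ∈ A, star x ∈ A) ∧ IsClosed A

/-- `A` acts nondegenerately on `H` (as in the universal representation). -/
def Nondegenerate (A : Set (H →L[ℂ] H)) : Prop :=
  ∀ x : H, ∀ ε : ℝ, 0 < ε → ∃ a ∈ A, ‖a x - x‖ < ε

/-- The closure of a set of operators in the strong operator topology.  For a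
C*-algebra `A` in its universal representation, `sotClosure A` is identified with
the bidual `A**`. -/
def sotClosure (S : Set (H →L[ℂ] H)) : Set (H →L[ℂ] H) :=
  {T | ∀ ε : ℝ, 0 < ε → ∀ v : Finset H, ∃ s ∈ S, ∀ x ∈ v, ‖T x - s x‖ < ε}

/-- An orthogonal projection (self-adjoint idempotent). -/
def IsProjectionOp (p : H →L[ℂ] H) : Prop := IsSelfAdjoint p ∧ IsIdempotentElem p

/-- Convergence of a sequence of operators in the strong operator topology. -/
def SOTTendsto (T : ℕ → H →L[ℂ] H) (S : H →L[ℂ] H) : Prop :=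
  ∀ x : H, Tendsto (fun n => T n x) atTop (𝓝 (S x))

/-- A projection `p ∈ A**` is open if it is the strong limit of an increasing net of
positive elements of `A`. -/
def IsOpenProjection (A : Set (H →L[ℂ] H)) (p : H →L[ℂ] H) : Prop :=
  IsProjectionOp p ∧
    ∃ (ι : Type) (le : ι → ι → Prop) (a : ι → H →L[ℂ] H),
      Nonempty ι ∧ (∀ i, le i i) ∧ (∀ i j k, le i j → le j k → le i k) ∧
      (∀ i j, ∃ k, le i k ∧ le j k) ∧
      (∀ i, a i ∈ A) ∧ (∀ i, (a i).IsPositive) ∧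
      (∀ i j, le i j → opLE (a i) (a j)) ∧
      ∀ x : H, ∀ ε : ℝ, 0 < ε → ∃ i, ∀ j, le i j → ‖a j x - p x‖ < ε

/-- The hereditary subalgebra `A_p = pA**p ∩ A = pAp ∩ A` associated to a projection
`p ∈ A**`. -/
def her (A : Set (H →L[ℂ] H)) (p : H →L[ℂ] H) : Set (H →L[ℂ] H) :=
  {a | a ∈ A ∧ p * a * p = a}

/-- A projection is closed if its complement is open. -/
def IsClosedProjection (A : Set (H →L[ℂ] H)) (p : H →L[ℂ] H) : Prop :=
  IsProjectionOp p ∧ IsOpenProjection A (1 - p)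

/-- `c` is the closure `p̄` of the open projection `p`: the least closed projection
dominating `p`. -/
def IsClosureOf (A : Set (H →L[ℂ] H)) (p c : H →L[ℂ] H) : Prop :=
  IsClosedProjection A c ∧ opLE p c ∧
    ∀ q, IsClosedProjection A q → opLE p q → opLE c q

/-- Compact containment `p ⊂⊂ q` of open projections: the closure of `p` is compact in
`A_q`, i.e. `p̄ a = p̄` for some positive contraction `a ∈ A_q`. -/
def IsCompactlyContained (A : Set (H →L[ℂ] H)) (p q : H →L[ℂ] H) : Prop :=
  ∃ c, IsClosureOf A p c ∧ ∃ a ∈ her A q, a.IsPositive ∧ ‖a‖ ≤ 1 ∧ c * a = c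

/-- Peligrad–Zsidó equivalence of open projections. -/
def PZEquiv (A : Set (H →L[ℂ] H)) (p q : H →L[ℂ] H) : Prop :=
  ∃ v ∈ sotClosure A, star v * v = p ∧ v * star v = q ∧
    (∀ a ∈ her A p, v * a ∈ A) ∧ ∀ a ∈ her A q, star v * a ∈ A

/-- Cuntz subequivalence of open projections: `p ≾ q` iff every `p' ⊂⊂ p` is
PZ-equivalent to some `q' ⊂⊂ q`. -/
def CuLE (A : Set (H →L[ℂ] H)) (p q : H →L[ℂ] H) : Prop :=
  ∀ p', IsOpenProjection A p' → IsCompactlyContained A p' p →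
    ∃ q', IsOpenProjection A q' ∧ IsCompactlyContained A q' q ∧ PZEquiv A p' q'

/-- Cuntz equivalence of open projections. -/
def CuEquiv (A : Set (H →L[ℂ] H)) (p q : H →L[ℂ] H) : Prop :=
  CuLE A p q ∧ CuLE A q p

/-- Compact subequivalence `p ≺≺ q`: `p` is PZ-equivalent to some `q' ⊂⊂ q`. -/
def CompactSubequiv (A : Set (H →L[ℂ] H)) (p q : H →L[ℂ] H) : Prop :=
  ∃ q', IsOpenProjection A q' ∧ IsCompactlyContained A q' q ∧ PZEquiv A p q'

/-- The multiplier algebra of `A`, concretely realized (for a nondegenerate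
representation) as the idealizer of `A` in `B(H)`. -/
def multiplierSet (A : Set (H →L[ℂ] H)) : Set (H →L[ℂ] H) :=
  {x | ∀ a ∈ A, x * a ∈ A ∧ a * x ∈ A}

/-- Convergence of a net of operators in the strict topology determined by `A`. -/
def StrictTendsto (A : Set (H →L[ℂ] H)) {ι : Type*} (le : ι → ι → Prop)
    (a : ι → H →L[ℂ] H) (x : H →L[ℂ] H) : Prop :=
  ∀ b ∈ A, ∀ ε : ℝ, 0 < ε → ∃ i, ∀ j, le i j →
    ‖a j * b - x * b‖ < ε ∧ ‖b * a j - b * x‖ < ε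

/-- `A` is stable (i.e. of the form `A₀ ⊗ K`): there is a sequence of isometries in
`M(A)` with pairwise orthogonal ranges adding up strictly to the identity. -/
def IsStableAlg (A : Set (H →L[ℂ] H)) : Prop :=
  ∃ s : ℕ → H →L[ℂ] H, (∀ n, s n ∈ multiplierSet A) ∧
    (∀ n, star (s n) * s n = 1) ∧ (∀ m n, m ≠ n → star (s m) * s n = 0) ∧
    StrictTendsto A (· ≤ ·) (fun N => ∑ n ∈ Finset.range N, s n * star (s n)) 1

/-- A *-isomorphism between two (concrete) C*-algebras given as subsets of `B(H)`. -/
def StarAlgEquivOn (S T : Set (H →L[ℂ] H)) : Prop :=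
  ∃ f : (H →L[ℂ] H) → (H →L[ℂ] H), Set.BijOn f S T ∧
    (∀ x ∈ S, ∀ y ∈ S, f (x + y) = f x + f y) ∧
    (∀ x ∈ S, ∀ y ∈ S, f (x * y) = f x * f y) ∧
    (∀ (c : ℂ), ∀ x ∈ S, f (c • x) = c • f x) ∧
    ∀ x ∈ S, f (star x) = star (f x)

/-- A hereditary sub-C*-algebra of `A`. -/
def IsHereditarySubalg (A C : Set (H →L[ℂ] H)) : Prop :=
  C ⊆ A ∧ IsClosed C ∧ (0 : H →L[ℂ] H) ∈ C ∧
    (∀ x ∈ C, ∀ y ∈ C, x + y ∈ C) ∧ (∀ (c : ℂ), ∀ x ∈ C, c • x ∈ C) ∧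
    (∀ x ∈ C, ∀ y ∈ C, x * y ∈ C) ∧ (∀ x ∈ C, star x ∈ C) ∧
    ∀ x ∈ C, ∀ a ∈ A, ∀ y ∈ C, x * a * y ∈ C


section helpers

theorem mem_cfc {C : Set (H →L[ℂ] H)} (hC : IsCStarSubalg C) {a : H →L[ℂ] H} (ha : a ∈ C)
    (f : ℝ → ℝ) (hf : Continuous f) (h0 : f 0 = 0) : cfc f a ∈ C := by
  obtain ⟨h1, h2, h3, h4, h5, h6⟩ := hC
  let S : NonUnitalStarSubalgebra ℂ (H →L[ℂ] H) :=
    { carrier := C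
      zero_mem' := h1
      add_mem' := fun {x y} hx hy => h2 x hx y hy
      mul_mem' := fun {x y} hx hy => h4 x hx y hy
      smul_mem' := fun c x hx => h3 c x hx
      star_mem' := fun {x} hx => h5 x hx }
  rw [← cfcₙ_eq_cfc (hf := hf.continuousOn) (hf0 := h0)]
  have : IsClosed (S : Set (H →L[ℂ] H)) := h6
  exact cfcₙ_mem (𝕜' := ℂ) (s := S) f ha

theorem sa_of_nonneg {a : H →L[ℂ] H} (ha : 0 ≤ a) : star a = a := (IsSelfAdjoint.of_nonneg ha).star_eq

theorem star_cfc (f : ℝ → ℝ) (a : H →L[ℂ] H) : star (cfc f a) = cfc f a :=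
  (IsSelfAdjoint.cfc (f := f) (a := a)).star_eq

/-- norm of cfc bounded -/
theorem norm_cfc_bd {a : H →L[ℂ] H} (ha : 0 ≤ a) (f : ℝ → ℝ) {c : ℝ} (hc : 0 ≤ c)
    (h : ∀ t, 0 ≤ t → t ≤ ‖a‖ → |f t| ≤ c) : ‖cfc f a‖ ≤ c := by
  refine norm_cfc_le hc fun x hx => ?_
  have h1 := spectrum_nonneg_of_nonneg ha hx
  have h2 : ‖x‖ ≤ ‖a‖ * ‖(1 : H →L[ℂ] H)‖ := spectrum.norm_le_norm_mul_of_mem hx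
  have h3 : ‖(1 : H →L[ℂ] H)‖ ≤ 1 := ContinuousLinearMap.norm_id_le
  have h4 : ‖a‖ * ‖(1 : H →L[ℂ] H)‖ ≤ ‖a‖ := by
    simpa using mul_le_mul_of_nonneg_left h3 (norm_nonneg a)
  rw [Real.norm_of_nonneg h1] at h2
  exact h x h1 (h2.trans h4)

/-- The basic estimate. -/
theorem norm_mul_sq_le {T x a : H →L[ℂ] H} (hT : star T = T) {C : ℝ} (hC : 0 ≤ C)
    (h : x * star x ≤ C • a) : ‖T * x‖ ^ 2 ≤ C * ‖T * a * T‖ := by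
  have h1 : ‖T * x‖ ^ 2 = ‖T * (x * star x) * T‖ := by
    rw [sq, ← CStarRing.norm_self_mul_star]; simp [hT, mul_assoc]
  have h2 : T * (x * star x) * T ≤ T * (C • a) * T := by
    simpa [hT] using star_left_conjugate_le_conjugate h T
  have h0 : 0 ≤ T * (x * star x) * T := by
    have := mul_star_self_nonneg (T * x)
    simpa [hT, mul_assoc] using this
  rw [h1]
  refine (CStarAlgebra.norm_le_norm_of_nonneg_of_le h0 h2).trans ?_
  rw [mul_smul_comm, smul_mul_assoc, norm_smul, Real.norm_of_nonneg hC]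

theorem mem_of_tendsto' {C : Set (H →L[ℂ] H)} (hC : IsCStarSubalg C) {u : ℕ → H →L[ℂ] H}
    {x : H →L[ℂ] H} (hu : ∀ n, u n ∈ C) (h : Tendsto u atTop (𝓝 x)) : x ∈ C :=
  hC.2.2.2.2.2.mem_of_tendsto h (Eventually.of_forall hu)

/-- Factorization lemma. -/
theorem factor {B : Set (H →L[ℂ] H)} (hB : IsCStarSubalg B) {z g : H →L[ℂ] H} (hz : z ∈ B)
    (hg : g ∈ B) (hgs : star g = g) {δ : ℝ} (hδ : 0 < δ) (h : δ • (g * g) ≤ star z * z) :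
    ∃ W ∈ B, star W * W = g * g ∧ ∀ T : H →L[ℂ] H, T * z = z → T * W = W := by
  set y := star z * z with hy
  have hy0 : 0 ≤ y := star_mul_self_nonneg z
  have hyB : y ∈ B := hB.2.2.2.1 _ (hB.2.2.2.2.1 _ hz) _ hz
  have hle : g * star g ≤ δ⁻¹ • y := by
    rw [hgs]
    have := smul_le_smul_of_nonneg_left h (inv_nonneg.2 hδ.le)
    rwa [smul_smul, inv_mul_cancel₀ hδ.ne', one_smul] at this
  let c : ℕ → ℝ := fun n => 1 / ((n : ℝ) + 1)
  have hc : ∀ n, 0 < c n := fun n => by positivity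
  let wf : ℕ → ℝ → ℝ := fun n t => Real.sqrt t / (|t| + c n)
  let gf : ℕ → ℝ → ℝ := fun n t => |t| / (|t| + c n)
  have hden : ∀ n t, |t| + c n ≠ 0 := fun n t => by
    have := hc n; have := abs_nonneg t; positivity
  have hwc : ∀ n, Continuous (wf n) := fun n => by
    refine Continuous.div (by fun_prop) (by fun_prop) (hden n)
  have hgc : ∀ n, Continuous (gf n) := fun n => by
    refine Continuous.div (by fun_prop) (by fun_prop) (hden n)
  let G : ℕ → H →L[ℂ] H := fun n => cfc (gf n) y
  let w : ℕ → H →L[ℂ] H := fun n => cfc (wf n) y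
  have hGs : ∀ n, star (G n) = G n := fun n => star_cfc _ _
  have hws : ∀ n, star (w n) = w n := fun n => star_cfc _ _
  have hwy : ∀ n m, w n * y * w m = G n * G m := by
    intro n m
    have e1 : y = cfc (fun t : ℝ => t) y := (cfc_id' ℝ y).symm
    show cfc (wf n) y * y * cfc (wf m) y = cfc (gf n) y * cfc (gf m) y
    have := hwc n; have := hwc m; have := hgc n; have := hgc m
    conv_lhs => enter [1, 2]; rw [e1]
    rw [← cfc_mul _ _ y (by fun_prop) (by fun_prop), ← cfc_mul _ _ y (by fun_prop) (by fun_prop),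
      ← cfc_mul _ _ y (by fun_prop) (by fun_prop)]
    refine cfc_congr fun t ht => ?_
    have ht0 : 0 ≤ t := spectrum_nonneg_of_nonneg hy0 ht
    have hs := Real.mul_self_sqrt ht0
    simp only [wf, gf, abs_of_nonneg ht0]
    rw [div_mul_eq_mul_div, div_mul_div_comm, div_mul_div_comm]
    congr 1
    calc _ = (√t * √t) * t := by ring
      _ = _ := by rw [hs]
  -- key estimate
  have key : ∀ n, ‖(1 - G n) * g‖ ^ 2 ≤ δ⁻¹ * c n := by
    intro n
    refine (norm_mul_sq_le (by simp [hGs]) (inv_nonneg.2 hδ.le) hle).trans ?_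
    refine mul_le_mul_of_nonneg_left ?_ (inv_nonneg.2 hδ.le)
    have e1 : y = cfc (fun t : ℝ => t) y := (cfc_id' ℝ y).symm
    have e2 : (1 - G n) = cfc (fun t : ℝ => 1 - gf n t) y := by
      have := hgc n
      rw [cfc_sub (fun _ => (1 : ℝ)) (gf n) y (by fun_prop) (by fun_prop), cfc_const_one ℝ y (IsSelfAdjoint.of_nonneg hy0)]
    have hcc : Continuous (fun t : ℝ => 1 - gf n t) := by have := hgc n; fun_prop
    have e3 : (1 - G n) * y * (1 - G n) = cfc (fun t : ℝ => (1 - gf n t) * t * (1 - gf n t)) y := by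
      rw [cfc_mul _ _ y (by fun_prop) (by fun_prop), cfc_mul _ _ y (by fun_prop) (by fun_prop),
        ← e2, ← e1]
    rw [e3]
    refine norm_cfc_bd hy0 _ (hc n).le fun t ht _ => ?_
    have hcn := hc n
    have : 1 - gf n t = c n / (t + c n) := by
      simp only [gf, abs_of_nonneg ht]; field_simp; ring
    rw [this, abs_of_nonneg (by positivity)]
    rw [div_mul_eq_mul_div, div_mul_div_comm, div_le_iff₀ (by positivity)]
    nlinarith [mul_nonneg ht hcn.le, mul_pos hcn hcn, mul_nonneg (mul_nonneg ht hcn.le) hcn.le,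
      mul_nonneg (mul_nonneg ht ht) hcn.le, mul_pos (mul_pos hcn hcn) hcn]
  have hc0 : Tendsto c atTop (𝓝 0) := tendsto_one_div_add_atTop_nhds_zero_nat
  have key2 : Tendsto (fun n => ‖(1 - G n) * g‖) atTop (𝓝 0) := by
    have h1 : Tendsto (fun n => δ⁻¹ * c n) atTop (𝓝 0) := by simpa using hc0.const_mul δ⁻¹
    have h2 : Tendsto (fun n => ‖(1 - G n) * g‖ ^ 2) atTop (𝓝 0) :=
      squeeze_zero (fun n => by positivity) key h1
    have h3 := h2.sqrt
    simpa [Real.sqrt_sq] using h3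
  let D : ℕ → H →L[ℂ] H := fun n => z * w n * g
  have hD : ∀ n m, ‖D n - D m‖ = ‖(G n - G m) * g‖ := by
    intro n m
    have : ‖D n - D m‖ * ‖D n - D m‖ = ‖(G n - G m) * g‖ * ‖(G n - G m) * g‖ := by
      rw [← CStarRing.norm_star_mul_self, ← CStarRing.norm_star_mul_self]
      congr 1
      calc star (D n - D m) * (D n - D m)
          = g * (w n * y * w n - w n * y * w m - w m * y * w n + w m * y * w m) * g := by
            simp only [D, star_sub, star_mul, hws, hgs, hy]; noncomm_ring
        _ = _ := by
            simp only [hwy, star_sub, star_mul, hGs, hgs]; noncomm_ring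
    exact (mul_self_inj (norm_nonneg _) (norm_nonneg _)).1 this
  have hDc : CauchySeq D := by
    have hb : Tendsto (fun n => G n * g) atTop (𝓝 g) := by
      rw [tendsto_iff_norm_sub_tendsto_zero]
      refine key2.congr fun n => ?_
      rw [← norm_neg]; congr 1; noncomm_ring
    have := hb.cauchySeq
    rw [Metric.cauchySeq_iff] at this ⊢
    intro ε hε
    obtain ⟨N, hN⟩ := this ε hε
    refine ⟨N, fun m hm n hn => ?_⟩
    have := hN m hm n hn
    rwa [dist_eq_norm, ← sub_mul, ← hD, ← dist_eq_norm] at this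
  obtain ⟨W, hW⟩ := cauchySeq_tendsto_of_complete hDc
  refine ⟨W, mem_of_tendsto' hB (fun n => ?_) hW, ?_, ?_⟩
  · exact hB.2.2.2.1 _ (hB.2.2.2.1 _ hz _ (mem_cfc hB hyB _ (hwc n) (by simp [wf]))) _ hg
  · have h1 : Tendsto (fun n => star (D n) * D n) atTop (𝓝 (star W * W)) := hW.star.mul hW
    have hb : Tendsto (fun n => G n * g) atTop (𝓝 g) := by
      rw [tendsto_iff_norm_sub_tendsto_zero]
      refine key2.congr fun n => ?_
      rw [← norm_neg]; congr 1; noncomm_ring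
    have h2 : Tendsto (fun n => star (G n * g) * (G n * g)) atTop (𝓝 (star g * g)) :=
      hb.star.mul hb
    rw [hgs] at h2
    refine tendsto_nhds_unique h1 (h2.congr fun n => ?_)
    calc star (G n * g) * (G n * g) = g * (G n * G n) * g := by
          simp only [star_mul, hGs, hgs]; noncomm_ring
      _ = _ := by rw [← hwy]; simp only [D, star_mul, hws, hgs, hy]; noncomm_ring
  · intro T hT
    refine tendsto_nhds_unique (hW.const_mul T) (hW.congr fun n => ?_)
    simp only [D, ← mul_assoc, hT]


/-- auxiliary function -/
noncomputable def phi (t : ℝ) : ℝ := max 0 (2 * t - 1)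

theorem phi_cont : Continuous phi := by unfold phi; fun_prop

theorem phi_nonneg (t : ℝ) : 0 ≤ phi t := le_max_left _ _

theorem phi_fix {e x : H →L[ℂ] H} (he : 0 ≤ e) (h : e * x = x) : cfc phi e * x = x := by
  have hsa : IsSelfAdjoint e := IsSelfAdjoint.of_nonneg he
  let k : ℝ → ℝ := fun t => 1 / max (1 - t) (1 / 2)
  have hk : Continuous k := by
    refine Continuous.div (by fun_prop) (by fun_prop) fun t => ?_
    have : (1 / 2 : ℝ) ≤ max (1 - t) (1 / 2) := le_max_right _ _
    positivity
  have h1 : cfc (fun t => 1 - phi t) e = 1 - cfc phi e := by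
    have := phi_cont
    rw [cfc_sub (fun _ => (1 : ℝ)) phi e (by fun_prop) (by fun_prop), cfc_const_one ℝ e]
  have h2 : cfc (fun t : ℝ => 1 - t) e = 1 - e := by
    rw [cfc_sub (fun _ => (1 : ℝ)) (fun t => t) e (by fun_prop) (by fun_prop), cfc_const_one ℝ e,
      cfc_id' ℝ e]
  have h3 : cfc (fun t => 1 - phi t) e = cfc k e * cfc (fun t : ℝ => 1 - t) e := by
    rw [← cfc_mul _ _ e (by fun_prop) (by fun_prop)]
    congr 1
    funext t
    simp only [phi, k]
    rcases le_total (1 - t) (1 / 2) with h | h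
    · rw [max_eq_right h, max_eq_right (by linarith)]; ring
    · rw [max_eq_left h, max_eq_left (by linarith)]
      have : (1 - t) ≠ 0 := by intro h0; linarith
      field_simp; ring
  have h4 : (1 - cfc phi e) * x = 0 := by
    rw [← h1, h3, h2, mul_assoc, sub_mul, one_mul, h, sub_self, mul_zero]
  rw [sub_mul, one_mul, sub_eq_zero] at h4
  exact h4.symm

theorem norm_phi_le {e : H →L[ℂ] H} (he : 0 ≤ e) (h1 : ‖e‖ ≤ 1) : ‖cfc phi e‖ ≤ 1 := by
  refine norm_cfc_bd he _ zero_le_one fun t h0 ht => ?_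
  rw [abs_of_nonneg (phi_nonneg t)]
  simp only [phi]
  exact max_le zero_le_one (by linarith)

theorem norm_le_one_of_star {W : H →L[ℂ] H} (h : ‖star W * W‖ ≤ 1) : ‖W‖ ≤ 1 := by
  rw [CStarRing.norm_star_mul_self] at h
  nlinarith [norm_nonneg W]

theorem exact_of_approx {B : Set (H →L[ℂ] H)} (hB : IsCStarSubalg B) {e V : H →L[ℂ] H}
    (heB : e ∈ B) (he : 0 ≤ e) (hV : V ∈ B) (h : ‖star V * V - e‖ < 1 / 2) :
    ∃ W ∈ B, star W * W = cfc phi e ∧ ∀ T : H →L[ℂ] H, T * V = V → T * W = W := by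
  have hsa : IsSelfAdjoint e := IsSelfAdjoint.of_nonneg he
  let f : ℝ → ℝ := fun t => √(phi t)
  have hf : Continuous f := by have := phi_cont; fun_prop
  set g := cfc f e with hg
  have hgs : star g = g := star_cfc _ _
  have hgg : g * g = cfc phi e := by
    rw [hg, ← cfc_mul _ _ e (by fun_prop) (by fun_prop)]
    congr 1; funext t; exact Real.mul_self_sqrt (phi_nonneg t)
  have hgB : g ∈ B := mem_cfc hB heB f hf (by simp [f, phi])
  set η := ‖star V * V - e‖ with hη
  have h1 : e - star V * V ≤ algebraMap ℝ _ η := by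
    have hs : IsSelfAdjoint (e - star V * V) := hsa.sub (IsSelfAdjoint.star_mul_self V)
    have := hs.le_algebraMap_norm_self
    rwa [norm_sub_rev] at this
  have h2 : star g * (e - star V * V) * g ≤ star g * (algebraMap ℝ _ η) * g :=
    star_left_conjugate_le_conjugate h1 g
  have h3 : (1 / 2 : ℝ) • (g * g) ≤ g * e * g := by
    have e1 : g * e * g = cfc (fun t => f t * t * f t) e := by
      rw [cfc_mul _ _ e (by fun_prop) (by fun_prop), cfc_mul _ _ e (by fun_prop) (by fun_prop),
        cfc_id' ℝ e]
    have e2 : (1 / 2 : ℝ) • (g * g) = cfc (fun t => (1 / 2 : ℝ) * phi t) e := by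
      rw [hgg, cfc_const_mul _ _ e (phi_cont.continuousOn)]
    rw [e1, e2]
    have := phi_cont
    refine cfc_mono (fun t ht => ?_) (by fun_prop) (by fun_prop)
    have : f t * t * f t = t * phi t := by
      rw [mul_comm (f t) t, mul_assoc]; congr 1; exact Real.mul_self_sqrt (phi_nonneg t)
    rw [this]
    simp only [phi]
    rcases le_total (2 * t - 1) 0 with h | h
    · rw [max_eq_left h]; simp
    · rw [max_eq_right h]; nlinarith
  have h4 : (1 / 2 - η) • (g * g) ≤ star (V * g) * (V * g) := by
    have e3 : star g * (algebraMap ℝ _ η) * g = η • (g * g) := by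
      rw [hgs, Algebra.algebraMap_eq_smul_one, mul_smul_comm, mul_one, smul_mul_assoc]
    rw [e3, hgs] at h2
    have e4 : g * (e - star V * V) * g = g * e * g - star (V * g) * (V * g) := by
      rw [star_mul, hgs]; noncomm_ring
    rw [e4] at h2
    rw [sub_smul]
    have h5 := h3.trans (sub_le_iff_le_add.1 h2)
    rw [sub_le_iff_le_add]
    rwa [add_comm] at h5
  obtain ⟨W, hW, hWW, hT⟩ := factor hB (hB.2.2.2.1 _ hV _ hgB) hgB hgs (sub_pos.2 h) h4
  exact ⟨W, hW, hWW.trans hgg, fun T hTV => hT T (by rw [← mul_assoc, hTV])⟩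

/-- almost idempotent approximate unit -/
structure AU (C : Set (H →L[ℂ] H)) (U : ℕ → H →L[ℂ] H) : Prop where
  mem : ∀ k, U k ∈ C
  nonneg : ∀ k, 0 ≤ U k
  norm_le : ∀ k, ‖U k‖ ≤ 1
  succ : ∀ k, U (k + 1) * U k = U k
  lim : ∀ x ∈ C, Tendsto (fun k => U k * x) atTop (𝓝 x)

theorem exists_AU {C : Set (H →L[ℂ] H)} (hC : IsCStarSubalg C)
    (hs : TopologicalSpace.IsSeparable C) : ∃ U, AU C U := by
  obtain ⟨t, htC, htc, htd⟩ := hs.exists_countable_dense_subset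
  have hne : t.Nonempty := by
    rw [← closure_nonempty_iff]; exact ⟨0, htd hC.1⟩
  obtain ⟨x, rfl⟩ := htc.exists_eq_range hne
  have hx : ∀ i, x i ∈ C := fun i => htC ⟨i, rfl⟩
  let c : ℕ → ℝ := fun i => (1 / 2) ^ i / (1 + ‖x i‖ ^ 2)
  have hc : ∀ i, 0 < c i := fun i => by positivity
  let y : ℕ → H →L[ℂ] H := fun i => c i • (x i * star (x i))
  have hy0 : ∀ i, 0 ≤ y i := fun i => smul_nonneg (hc i).le (mul_star_self_nonneg _)
  have hyn : ∀ i, ‖y i‖ ≤ (1 / 2) ^ i := by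
    intro i
    simp only [y, norm_smul, Real.norm_of_nonneg (hc i).le, CStarRing.norm_self_mul_star, c]
    rw [div_mul_eq_mul_div, div_le_iff₀ (by positivity)]
    refine mul_le_mul_of_nonneg_left ?_ (by positivity)
    nlinarith
  have hsum : Summable y := Summable.of_norm_bounded summable_geometric_two hyn
  have hyC : ∀ i, y i ∈ C := by
    intro i
    have := hC.2.2.1 (c i : ℂ) _ (hC.2.2.2.1 _ (hx i) _ (hC.2.2.2.2.1 _ (hx i)))
    simpa [y] using this
  set a := ∑' i, y i with ha
  have haC : a ∈ C := by
    refine hC.2.2.2.2.2.mem_of_tendsto hsum.hasSum (Eventually.of_forall fun s => ?_)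
    induction s using Finset.induction_on with
    | empty => simpa using hC.1
    | insert i s hi ih => rw [Finset.sum_insert hi]; exact hC.2.1 _ (hyC i) _ ih
  have ha0 : 0 ≤ a := tsum_nonneg hy0
  have hsa : IsSelfAdjoint a := IsSelfAdjoint.of_nonneg ha0
  have hle : ∀ i, x i * star (x i) ≤ (c i)⁻¹ • a := by
    intro i
    have h1 : y i ≤ a := hsum.le_tsum i (fun j _ => hy0 j)
    have := smul_le_smul_of_nonneg_left h1 (inv_nonneg.2 (hc i).le)
    simpa only [y, smul_smul, inv_mul_cancel₀ (hc i).ne', one_smul] using this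
  let f : ℕ → ℝ → ℝ := fun k t => min 1 (max 0 (2 ^ (k + 1) * t - 1))
  have hf : ∀ k, Continuous (f k) := fun k => by fun_prop
  have hf0 : ∀ k t, 0 ≤ f k t := fun k t => le_min zero_le_one (le_max_left _ _)
  have hf1 : ∀ k t, f k t ≤ 1 := fun k t => min_le_left _ _
  let U : ℕ → H →L[ℂ] H := fun k => cfc (f k) a
  have hUn : ∀ k, ‖U k‖ ≤ 1 := fun k => norm_cfc_bd ha0 _ zero_le_one fun t _ _ => by
    rw [abs_of_nonneg (hf0 k t)]; exact hf1 k t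
  have hlimx : ∀ i, Tendsto (fun k => U k * x i) atTop (𝓝 (x i)) := by
    intro i
    have est : ∀ k, ‖(1 - U k) * x i‖ ^ 2 ≤ (c i)⁻¹ * (1 / 2) ^ k := by
      intro k
      refine (norm_mul_sq_le (by simp [U, star_cfc]) (inv_nonneg.2 (hc i).le) (hle i)).trans ?_
      refine mul_le_mul_of_nonneg_left ?_ (inv_nonneg.2 (hc i).le)
      have e2 : (1 - U k) = cfc (fun t : ℝ => 1 - f k t) a := by
        have := hf k
        rw [cfc_sub (fun _ => (1 : ℝ)) (f k) a (by fun_prop) (by fun_prop), cfc_const_one ℝ a]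
      have e3 : (1 - U k) * a * (1 - U k)
          = cfc (fun t : ℝ => (1 - f k t) * t * (1 - f k t)) a := by
        have := hf k
        rw [cfc_mul _ _ a (by fun_prop) (by fun_prop), cfc_mul _ _ a (by fun_prop) (by fun_prop),
          ← e2, cfc_id' ℝ a]
      rw [e3]
      refine norm_cfc_bd ha0 _ (by positivity) fun t ht _ => ?_
      have g0 := hf0 k t
      have g1 := hf1 k t
      have h1 : 0 ≤ 1 - f k t := by linarith
      rw [abs_of_nonneg (by positivity)]
      have h2 : (2 : ℝ) ^ k * (1 / 2) ^ k = 1 := by rw [← mul_pow]; norm_num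
      by_cases hh : t ≤ (1 / 2) ^ k
      · have : (1 - f k t) * t * (1 - f k t) ≤ 1 * t * 1 := by gcongr <;> linarith
        linarith
      · push Not at hh
        have h3 : 1 ≤ (2 : ℝ) ^ k * t := by
          rw [← h2]; gcongr
        have : f k t = 1 := by
          simp only [f]
          refine min_eq_left (le_max_of_le_right ?_)
          rw [pow_succ]; linarith
        rw [this]; simp
    have h1 : Tendsto (fun k : ℕ => (c i)⁻¹ * (1 / 2 : ℝ) ^ k) atTop (𝓝 0) := by
      simpa using (tendsto_pow_atTop_nhds_zero_of_lt_one (r := (1 / 2 : ℝ)) (by norm_num)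
        (by norm_num)).const_mul (c i)⁻¹
    have h3 := (squeeze_zero (fun k => by positivity) est h1).sqrt
    rw [tendsto_iff_norm_sub_tendsto_zero]
    simp only [Real.sqrt_sq (norm_nonneg _), Real.sqrt_zero] at h3
    refine h3.congr fun k => ?_
    rw [← norm_neg]; congr 1; noncomm_ring
  refine ⟨U, fun k => mem_cfc hC haC _ (hf k) (by simp [f]), fun k => cfc_nonneg fun t _ => hf0 k t,
    hUn, fun k => ?_, ?_⟩
  · show cfc _ a * cfc _ a = cfc _ a
    have := hf k
    have := hf (k + 1)
    rw [← cfc_mul _ _ a (by fun_prop) (by fun_prop)]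
    congr 1; funext t
    by_cases hh : 2 ^ (k + 1) * t ≤ 1
    · have : f k t = 0 := by
        simp only [f]; rw [max_eq_left (by linarith)]; simp
      rw [this, mul_zero]
    · push Not at hh
      have : f (k + 1) t = 1 := by
        simp only [f]
        refine min_eq_left (le_max_of_le_right ?_)
        rw [pow_succ]; linarith
      rw [this, one_mul]
  · intro z hz
    rw [Metric.tendsto_atTop]
    intro ε hε
    obtain ⟨_, ⟨i, rfl⟩, hi⟩ := Metric.mem_closure_iff.1 (htd hz) (ε / 3) (by positivity)
    obtain ⟨N, hN⟩ := Metric.tendsto_atTop.1 (hlimx i) (ε / 3) (by positivity)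
    refine ⟨N, fun k hk => ?_⟩
    have h1 := hN k hk
    rw [dist_eq_norm] at h1 hi ⊢
    have h2 : ‖U k * (z - x i)‖ ≤ 1 * ‖z - x i‖ :=
      (norm_mul_le _ _).trans (mul_le_mul_of_nonneg_right (hUn k) (norm_nonneg _))
    calc ‖U k * z - z‖ = ‖U k * (z - x i) + (U k * x i - x i) - (z - x i)‖ := by
          congr 1; noncomm_ring
      _ ≤ ‖U k * (z - x i)‖ + ‖U k * x i - x i‖ + ‖z - x i‖ :=
          (norm_sub_le _ _).trans (add_le_add_left (norm_add_le _ _) _)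
      _ < ε := by linarith


/-- almost idempotent sequences -/
structure AI (U : ℕ → H →L[ℂ] H) : Prop where
  nonneg : ∀ k, 0 ≤ U k
  norm_le : ∀ k, ‖U k‖ ≤ 1
  succ : ∀ k, U (k + 1) * U k = U k

theorem AU.ai {C : Set (H →L[ℂ] H)} {U : ℕ → H →L[ℂ] H} (h : AU C U) : AI U :=
  ⟨h.nonneg, h.norm_le, h.succ⟩

theorem AI.lt {U : ℕ → H →L[ℂ] H} (h : AI U) {k l : ℕ} (hkl : k < l) : U l * U k = U k := by
  induction l, hkl using Nat.le_induction with
  | base => exact h.succ k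
  | succ l hl ih => rw [← ih, ← mul_assoc, h.succ l]

theorem AI.mono {U : ℕ → H →L[ℂ] H} (h : AI U) : Monotone U := by
  refine monotone_nat_of_le_succ fun k => ?_
  have s1 : star (U (k + 1)) = U (k + 1) := sa_of_nonneg (h.nonneg _)
  have h1 : U k ≤ 1 := (CStarAlgebra.norm_le_one_iff_of_nonneg _ (h.nonneg k)).1 (h.norm_le k)
  have h2 : U (k + 1) ≤ 1 := (CStarAlgebra.norm_le_one_iff_of_nonneg _ (h.nonneg _)).1 (h.norm_le _)
  have h3 : U k * U (k + 1) = U k := by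
    have := congrArg star (h.succ k)
    rwa [star_mul, sa_of_nonneg (h.nonneg _), sa_of_nonneg (h.nonneg _)] at this
  have h4 := star_left_conjugate_le_conjugate h1 (U (k + 1))
  rw [s1, h.succ, h3, mul_one] at h4
  refine h4.trans ?_
  have h5 := star_left_conjugate_nonneg (sub_nonneg.2 h2) (U (k + 1))
  have h6 := star_left_conjugate_nonneg (h.nonneg (k + 1)) (1 - U (k + 1))
  have h7 := add_nonneg h5 h6
  rw [← sub_nonneg]
  convert h7 using 1
  simp only [star_sub, star_one, s1]
  noncomm_ring

theorem AI.exists_lim {U : ℕ → H →L[ℂ] H} (h : AI U) : ∃ e : H →L[ℂ] H, IsProjectionOp e ∧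
    SOTTendsto U e ∧ ∀ k, e * U k = U k := by
  let K : Submodule ℂ H := (⨆ k, LinearMap.range (U k : H →ₗ[ℂ] H)).topologicalClosure
  have hK : ∀ k x, U k x ∈ K := fun k x =>
    Submodule.le_topologicalClosure _ (Submodule.mem_iSup_of_mem k ⟨x, rfl⟩)
  let S : Submodule ℂ H :=
    { carrier := {y | Tendsto (fun k => U k y) atTop (𝓝 y)}
      zero_mem' := by simp
      add_mem' := fun {x y} hx hy => by
        have := Tendsto.add (Set.mem_setOf_eq ▸ hx) hy
        simpa using this
      smul_mem' := fun c x hx => by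
        have := Tendsto.const_smul (Set.mem_setOf_eq ▸ hx) c
        simpa using this }
  have hcl : IsClosed (S : Set H) := by
    refine isClosed_of_closure_subset fun z hz => ?_
    show Tendsto (fun k => U k z) atTop (𝓝 z)
    rw [Metric.tendsto_atTop]
    intro ε hε
    obtain ⟨y, hy, hi⟩ := Metric.mem_closure_iff.1 hz (ε / 3) (by positivity)
    obtain ⟨N, hN⟩ := Metric.tendsto_atTop.1 (show Tendsto (fun k => U k y) atTop (𝓝 y) from hy)
      (ε / 3) (by positivity)
    refine ⟨N, fun k hk => ?_⟩
    have h1 := hN k hk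
    rw [dist_eq_norm] at h1 hi ⊢
    have h2 : ‖U k (z - y)‖ ≤ 1 * ‖z - y‖ := (U k).le_of_opNorm_le (h.norm_le k) _
    calc ‖U k z - z‖ = ‖U k (z - y) + (U k y - y) - (z - y)‖ := by
          congr 1; rw [map_sub]; abel
      _ ≤ ‖U k (z - y)‖ + ‖U k y - y‖ + ‖z - y‖ :=
          (norm_sub_le _ _).trans (add_le_add_left (norm_add_le _ _) _)
      _ < ε := by linarith
  have hKS : K ≤ S := by
    refine Submodule.topologicalClosure_minimal _ (iSup_le fun k => ?_) hcl
    rintro _ ⟨x, rfl⟩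
    refine tendsto_const_nhds.congr' ?_
    filter_upwards [eventually_gt_atTop k] with l hl
    exact (congrArg (fun T : H →L[ℂ] H => T x) (h.lt hl)).symm
  have : CompleteSpace K := (Submodule.isClosed_topologicalClosure _).completeSpace_coe
  refine ⟨K.starProjection, ⟨isSelfAdjoint_starProjection K, K.isIdempotentElem_starProjection⟩,
    fun x => ?_, fun k => ?_⟩
  · have h1 : Tendsto (fun k => U k (K.starProjection x)) atTop (𝓝 (K.starProjection x)) :=
      hKS (K.starProjection_apply_mem x)
    refine h1.congr fun k => ?_
    have h2 : x - K.starProjection x ∈ Kᗮ := K.sub_starProjection_mem_orthogonal x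
    have h3 : U k (x - K.starProjection x) = 0 := by
      rw [← inner_self_eq_zero (𝕜 := ℂ), ← ContinuousLinearMap.adjoint_inner_right,
        ← ContinuousLinearMap.star_eq_adjoint, sa_of_nonneg (h.nonneg k)]
      exact (Submodule.mem_orthogonal' _ _).1 h2 _ (hK k _)
    rw [map_sub, sub_eq_zero] at h3
    exact h3.symm
  · ext x
    exact Submodule.starProjection_eq_self_iff.2 (hK k x)

theorem SOT_unique {T S : H →L[ℂ] H} {U : ℕ → H →L[ℂ] H} {e : H →L[ℂ] H} (he : SOTTendsto U e)
    (h : ∀ k, T * U k = S * U k) : T * e = S * e := by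
  ext x
  have h1 : Tendsto (fun k => T (U k x)) atTop (𝓝 (T (e x))) :=
    (T.continuous.tendsto _).comp (he x)
  have h2 : Tendsto (fun k => S (U k x)) atTop (𝓝 (S (e x))) :=
    (S.continuous.tendsto _).comp (he x)
  exact tendsto_nhds_unique h1 (h2.congr fun k =>
    (congrArg (fun T : H →L[ℂ] H => T x) (h k)).symm)

theorem isOpen_of_AI {B : Set (H →L[ℂ] H)} {U : ℕ → H →L[ℂ] H} (h : AI U) (hB : ∀ k, U k ∈ B)
    {e : H →L[ℂ] H} (he : IsProjectionOp e) (hl : SOTTendsto U e) : IsOpenProjection B e := by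
  refine ⟨he, ℕ, (· ≤ ·), U, ⟨0⟩, fun i => le_refl i, fun i j k => le_trans,
    fun i j => ⟨max i j, le_max_left _ _, le_max_right _ _⟩, hB,
    fun i => (ContinuousLinearMap.nonneg_iff_isPositive _).1 (h.nonneg i),
    fun i j hij => h.mono hij, fun x ε hε => ?_⟩
  obtain ⟨N, hN⟩ := Metric.tendsto_atTop.1 (hl x) ε hε
  exact ⟨N, fun j hj => by simpa [dist_eq_norm] using hN j hj⟩

/-- fixed subalgebra -/
def fixAlg (B : Set (H →L[ℂ] H)) (d : H →L[ℂ] H) : Set (H →L[ℂ] H) :=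
  {x | x ∈ B ∧ d * x = x ∧ x * d = x}

theorem fixAlg_cstar {B : Set (H →L[ℂ] H)} (hB : IsCStarSubalg B) {d : H →L[ℂ] H}
    (hd : star d = d) : IsCStarSubalg (fixAlg B d) := by
  obtain ⟨h1, h2, h3, h4, h5, h6⟩ := hB
  refine ⟨⟨h1, by simp, by simp⟩, ?_, ?_, ?_, ?_, ?_⟩
  · rintro x ⟨hx, hx1, hx2⟩ y ⟨hy, hy1, hy2⟩
    exact ⟨h2 x hx y hy, by rw [mul_add, hx1, hy1], by rw [add_mul, hx2, hy2]⟩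
  · rintro c x ⟨hx, hx1, hx2⟩
    exact ⟨h3 c x hx, by rw [mul_smul_comm, hx1], by rw [smul_mul_assoc, hx2]⟩
  · rintro x ⟨hx, hx1, hx2⟩ y ⟨hy, hy1, hy2⟩
    exact ⟨h4 x hx y hy, by rw [← mul_assoc, hx1], by rw [mul_assoc, hy2]⟩
  · rintro x ⟨hx, hx1, hx2⟩
    exact ⟨h5 x hx, by have := congrArg star hx2; rwa [star_mul, hd] at this,
      by have := congrArg star hx1; rwa [star_mul, hd] at this⟩
  · have e : fixAlg B d = B ∩ ({x | d * x = x} ∩ {x | x * d = x}) := rfl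
    rw [e]
    exact h6.inter ((isClosed_eq (by fun_prop) (by fun_prop)).inter
      (isClosed_eq (by fun_prop) (by fun_prop)))

theorem her_eq {B : Set (H →L[ℂ] H)} {p : H →L[ℂ] H} (hp : IsProjectionOp p) :
    her B p = fixAlg B p := by
  have hi : p * p = p := hp.2
  ext x
  constructor
  · rintro ⟨hx, h⟩
    refine ⟨hx, ?_, ?_⟩
    · rw [← h, ← mul_assoc, ← mul_assoc, hi]
    · rw [← h, mul_assoc, hi]
  · rintro ⟨hx, h1, h2⟩
    exact ⟨hx, by rw [h1, h2]⟩

theorem fixAlg_sub (B : Set (H →L[ℂ] H)) (d : H →L[ℂ] H) : fixAlg B d ⊆ B := fun _ h => h.1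

/-- the open projection of a subalgebra -/
theorem exists_unit {B : Set (H →L[ℂ] H)} (hsep : TopologicalSpace.IsSeparable B)
    {C : Set (H →L[ℂ] H)} (hC : IsCStarSubalg C) (hCB : C ⊆ B) :
    ∃ e : H →L[ℂ] H, IsOpenProjection B e ∧ (∀ x ∈ C, e * x = x) ∧
      ∀ T S : H →L[ℂ] H, (∀ x ∈ C, T * x = S * x) → T * e = S * e := by
  obtain ⟨U, hU⟩ := exists_AU hC (hsep.mono hCB)
  obtain ⟨e, he, hl, heU⟩ := hU.ai.exists_lim
  refine ⟨e, isOpen_of_AI hU.ai (fun k => hCB (hU.mem k)) he hl, fun x hx => ?_, fun T S h =>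
    SOT_unique hl fun k => h _ (hU.mem k)⟩
  have h1 := hU.lim x hx
  refine tendsto_nhds_unique (h1.const_mul e) (h1.congr fun k => ?_)
  rw [← mul_assoc, heU]

theorem proj_le_iff {p q : H →L[ℂ] H} (hp : IsProjectionOp p) (hq : IsProjectionOp q) :
    opLE p q ↔ q * p = p := by
  have hps : star p = p := hp.1.star_eq
  have hqs : star q = q := hq.1.star_eq
  have hpi : p * p = p := hp.2
  have hqi : q * q = q := hq.2
  constructor
  · intro h
    have h1 : p ≤ q := h
    have h2 := star_left_conjugate_le_conjugate h1 (1 - q)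
    have e1 : star (1 - q) * q * (1 - q) = 0 := by
      have : star (1 - q) * q * (1 - q) = (q - q * q) * (1 - q) := by
        simp only [star_sub, star_one, hqs]; noncomm_ring
      rw [this, hqi]; simp
    have e2 : star (1 - q) * p * (1 - q) = star (p * (1 - q)) * (p * (1 - q)) := by
      rw [star_mul, hps, mul_assoc, mul_assoc, ← mul_assoc p p, hpi]
    rw [e1, e2] at h2
    have h3 := le_antisymm h2 (star_mul_self_nonneg _)
    rw [CStarRing.star_mul_self_eq_zero_iff] at h3
    have h4 := congrArg star h3
    rw [star_mul, hps] at h4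
    simp only [star_sub, star_one, hqs, star_zero, sub_mul, one_mul, sub_eq_zero] at h4
    exact h4.symm
  · intro h
    have h' : p * q = p := by
      have := congrArg star h
      rwa [star_mul, hps, hqs] at this
    show p ≤ q
    rw [← sub_nonneg]
    have : q - p = star (q - p) * (q - p) := by
      rw [star_sub, hps, hqs, sub_mul, mul_sub, mul_sub, h, h', hpi, hqi]; simp
    rw [this]
    exact star_mul_self_nonneg _

theorem pos_ker {a : H →L[ℂ] H} (ha : 0 ≤ a) {x : H} (h : RCLike.re (inner ℂ (a x) x) ≤ 0) :
    a x = 0 := by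
  set b := CFC.sqrt a
  have hb : star b = b := sa_of_nonneg (CFC.sqrt_nonneg a)
  have hbb : b * b = a := CFC.sqrt_mul_sqrt_self a ha
  have e1 : inner ℂ (a x) x = inner ℂ (b x) (b x) := by
    rw [← hbb]
    show inner ℂ (b (b x)) x = _
    rw [← ContinuousLinearMap.adjoint_inner_right, ← ContinuousLinearMap.star_eq_adjoint, hb]
  rw [e1, inner_self_eq_norm_sq] at h
  have h2 : ‖b x‖ = 0 := by nlinarith [norm_nonneg (b x)]
  have h3 : b x = 0 := norm_eq_zero.1 h2
  rw [← hbb]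
  show b (b x) = 0
  rw [h3, map_zero]

/-- normal form of openness -/
theorem open_net {B : Set (H →L[ℂ] H)} {p : H →L[ℂ] H} (hp : IsOpenProjection B p) :
    ∃ (ι : Type) (le : ι → ι → Prop) (a : ι → H →L[ℂ] H),
      Nonempty ι ∧ (∀ i, le i i) ∧ (∀ i j k, le i j → le j k → le i k) ∧
      (∀ i j, ∃ k, le i k ∧ le j k) ∧
      (∀ i, a i ∈ fixAlg B p) ∧ (∀ i, 0 ≤ a i) ∧
      (∀ i j, le i j → a i ≤ a j) ∧
      ∀ x : H, ∀ ε : ℝ, 0 < ε → ∃ i, ∀ j, le i j → ‖a j x - p x‖ < ε := by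
  obtain ⟨hpp, ι, le, a, hne, hr, ht, hd, hB, hpos, hm, hl⟩ := hp
  have hpos' : ∀ i, 0 ≤ a i := fun i => (ContinuousLinearMap.nonneg_iff_isPositive _).2 (hpos i)
  refine ⟨ι, le, a, hne, hr, ht, hd, fun i => ?_, hpos', hm, hl⟩
  have key : ∀ x, p x = 0 → a i x = 0 := by
    intro x hx
    apply pos_ker (hpos' i)
    refine le_of_forall_pos_le_add fun ε hε => ?_
    obtain ⟨j, hj⟩ := hl x (ε / (‖x‖ + 1)) (by positivity)
    obtain ⟨k, hik, hjk⟩ := hd i j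
    have h1 := hj k hjk
    rw [hx, sub_zero] at h1
    have h2 : 0 ≤ RCLike.re (inner ℂ ((a k - a i) x) x) := (hm i k hik).re_inner_nonneg_left x
    have h3 : RCLike.re (inner ℂ (a i x) x) ≤ RCLike.re (inner ℂ (a k x) x) := by
      simp only [ContinuousLinearMap.sub_apply, inner_sub_left, map_sub] at h2
      linarith
    have h4 : RCLike.re (inner ℂ (a k x) x) ≤ ‖a k x‖ * ‖x‖ := re_inner_le_norm _ _
    have h5 : ‖a k x‖ * ‖x‖ ≤ ε / (‖x‖ + 1) * (‖x‖ + 1) := by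
      gcongr; linarith
    rw [div_mul_cancel₀ _ (by positivity)] at h5
    linarith
  have e1 : a i * p = a i := by
    ext x
    have : p (x - p x) = 0 := by
      have := congrArg (fun T : H →L[ℂ] H => T x) hpp.2.eq
      rw [map_sub, sub_eq_zero]; exact this.symm
    have := key _ this
    rw [map_sub, sub_eq_zero] at this
    exact this.symm
  have e2 : p * a i = a i := by
    have := congrArg star e1
    rwa [star_mul, hpp.1.star_eq, sa_of_nonneg (hpos' i)] at this
  exact ⟨hB i, e2, e1⟩

theorem open_unique {B : Set (H →L[ℂ] H)} {p : H →L[ℂ] H} (hp : IsOpenProjection B p)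
    {T : H →L[ℂ] H} (h : ∀ x ∈ fixAlg B p, T * x = 0) : T * p = 0 := by
  obtain ⟨ι, le, a, hne, hr, ht, hd, hB, hpos, hm, hl⟩ := open_net hp
  ext x
  show T (p x) = 0
  rw [← norm_le_zero_iff]
  refine le_of_forall_pos_le_add fun ε hε => ?_
  obtain ⟨j, hj⟩ := hl x (ε / (‖T‖ + 1)) (by positivity)
  have h1 := hj j (hr j)
  have h2 : T (a j x) = 0 := congrArg (fun T : H →L[ℂ] H => T x) (h _ (hB j))
  have h3 : T (p x) = - T (a j x - p x) := by rw [map_sub, h2]; simp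
  rw [h3, norm_neg, zero_add]
  calc ‖T (a j x - p x)‖ ≤ ‖T‖ * ‖a j x - p x‖ := T.le_opNorm _
    _ ≤ (‖T‖ + 1) * (ε / (‖T‖ + 1)) := by gcongr; linarith
    _ = ε := by field_simp


theorem zero_of_sq {x : H →L[ℂ] H} (h : x * star x = 0) : x = 0 := by
  have := CStarRing.norm_self_mul_star (x := x)
  rw [h, norm_zero] at this
  exact norm_eq_zero.1 (mul_self_eq_zero.1 this.symm)

theorem zero_of_sq' {x : H →L[ℂ] H} (h : star x * x = 0) : x = 0 := by
  have := CStarRing.norm_star_mul_self (x := x)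
  rw [h, norm_zero] at this
  exact norm_eq_zero.1 (mul_self_eq_zero.1 this.symm)

theorem proj_compl {p : H →L[ℂ] H} (hp : IsProjectionOp p) : IsProjectionOp (1 - p) := by
  have h1 : star p = p := hp.1.star_eq
  have h2 : p * p = p := hp.2
  refine ⟨?_, ?_⟩
  · show star (1 - p) = 1 - p
    simp [h1]
  · show (1 - p) * (1 - p) = 1 - p
    simp [mul_sub, sub_mul, h2]

theorem nondeg_zero {B : Set (H →L[ℂ] H)} (hnd : Nondegenerate B) {S T : H →L[ℂ] H}
    (h : ∀ b ∈ B, S * b * T = 0) : S * T = 0 := by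
  ext x
  show S (T x) = 0
  rw [← norm_le_zero_iff]
  refine le_of_forall_pos_le_add fun ε hε => ?_
  obtain ⟨b, hb, hb'⟩ := hnd (T x) (ε / (‖S‖ + 1)) (by positivity)
  have h2 : S (b (T x)) = 0 := by
    have := congrArg (fun Y : H →L[ℂ] H => Y x) (h b hb)
    simpa using this
  have h3 : S (T x) = - S (b (T x) - T x) := by rw [map_sub, h2]; simp
  rw [h3, norm_neg, zero_add]
  calc ‖S (b (T x) - T x)‖ ≤ ‖S‖ * ‖b (T x) - T x‖ := S.le_opNorm _
    _ ≤ (‖S‖ + 1) * (ε / (‖S‖ + 1)) := by gcongr; linarith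
    _ = ε := by field_simp

theorem cc_of {B : Set (H →L[ℂ] H)} (hB : IsCStarSubalg B)
    (hsep : TopologicalSpace.IsSeparable B) (hnd : Nondegenerate B) {q' q a : H →L[ℂ] H}
    (hq' : IsProjectionOp q') (ha : a ∈ her B q) (ha0 : 0 ≤ a) (ha1 : ‖a‖ ≤ 1)
    (haq : a * q' = q') : IsCompactlyContained B q' q := by
  have hqs : star q' = q' := hq'.1.star_eq
  have hqi : q' * q' = q' := hq'.2
  have has : star a = a := sa_of_nonneg ha0
  have haq2 : q' * a = q' := by have := congrArg star haq; simpa [hqs, has] using this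
  have hN : IsCStarSubalg (fixAlg B (1 - q')) := fixAlg_cstar hB (by simp [hqs])
  obtain ⟨e, heo, heu, hun⟩ := exists_unit hsep hN (fixAlg_sub B _)
  have hes : star e = e := heo.1.1.star_eq
  have hei : e * e = e := heo.1.2
  have hc : IsProjectionOp (1 - e) := proj_compl heo.1
  have hq'e : q' * e = 0 := by
    have := hun q' 0 (fun x hx => by
      have h := hx.2.1
      rw [sub_mul, one_mul, sub_eq_self] at h
      simp [h])
    simpa using this
  have heq' : e * q' = 0 := by have := congrArg star hq'e; simpa [hqs, hes] using this
  refine ⟨1 - e, ⟨⟨hc, by simpa using heo⟩, ?_, ?_⟩, a, ha,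
    (ContinuousLinearMap.nonneg_iff_isPositive _).1 ha0, ha1, ?_⟩
  · rw [proj_le_iff hq' hc]; simp [sub_mul, heq']
  · intro r hr hle
    rw [proj_le_iff hq' hr.1] at hle
    rw [proj_le_iff hc hr.1]
    have hrs : star r = r := hr.1.1.star_eq
    have hle2 : q' * r = q' := by have := congrArg star hle; simpa [hqs, hrs] using this
    have h1 : (1 - e) * (1 - r) = 0 := by
      refine open_unique hr.2 fun x hx => ?_
      have hx' : x ∈ fixAlg B (1 - q') := by
        obtain ⟨hx0, hx1, hx2⟩ := hx
        have e1 : r * x = 0 := by simpa [sub_mul] using hx1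
        have e2 : x * r = 0 := by simpa [mul_sub] using hx2
        refine ⟨hx0, ?_, ?_⟩
        · rw [sub_mul, one_mul, ← hle2, mul_assoc, e1]; simp
        · rw [mul_sub, mul_one, ← hle, ← mul_assoc, e2]; simp
      rw [sub_mul, one_mul, heu x hx', sub_self]
    have h2 := congrArg star h1
    simp only [star_mul, star_sub, star_one, hes, hrs, star_zero] at h2
    rw [sub_mul, one_mul, sub_eq_zero] at h2
    exact h2.symm
  · have h1 : (1 - e) * (1 - a) * (1 - a) = 0 := by
      refine nondeg_zero hnd fun b hb => ?_
      have hm : (1 - a) * b * (1 - a) ∈ fixAlg B (1 - q') := by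
        have haB := ha.1
        refine ⟨?_, ?_, ?_⟩
        · have : (1 - a) * b * (1 - a) = b + (-1 : ℂ) • (a * b) + (-1 : ℂ) • (b * a) + a * b * a := by
            simp only [neg_smul, one_smul]; noncomm_ring
          rw [this]
          obtain ⟨g1, g2, g3, g4, g5, g6⟩ := hB
          exact g2 _ (g2 _ (g2 _ hb _ (g3 _ _ (g4 _ haB _ hb))) _ (g3 _ _ (g4 _ hb _ haB))) _
            (g4 _ (g4 _ haB _ hb) _ haB)
        · rw [sub_mul, one_mul, sub_eq_self, ← mul_assoc, ← mul_assoc, mul_sub q', mul_one, haq2]; simp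
        · rw [mul_sub, mul_one, sub_eq_self, mul_assoc, sub_mul 1 a q', one_mul, haq]; simp
      have := heu _ hm
      rw [show (1 - e) * (1 - a) * b * (1 - a) = (1 - a) * b * (1 - a) - e * ((1 - a) * b * (1 - a)) by
        noncomm_ring, this, sub_self]
    have h2 : (1 - e) * (1 - a) = 0 := by
      apply zero_of_sq
      rw [star_mul, star_sub, star_sub, star_one, has, hes, ← mul_assoc, h1, zero_mul]
    rw [mul_sub, mul_one, sub_eq_zero] at h2
    exact h2.symm

/-- Cuntz subequivalence by approximations. -/
def Sub (B : Set (H →L[ℂ] H)) (p q : H →L[ℂ] H) : Prop :=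
  ∀ e ∈ fixAlg B p, 0 ≤ e → ∀ ε : ℝ, 0 < ε → ∃ W ∈ B, q * W = W ∧ ‖star W * W - e‖ < ε

theorem cfc_fix_mem {B : Set (H →L[ℂ] H)} (hB : IsCStarSubalg B) {p e : H →L[ℂ] H}
    (hp : IsProjectionOp p) (he : e ∈ fixAlg B p) (f : ℝ → ℝ) (hf : Continuous f) (h0 : f 0 = 0) :
    cfc f e ∈ fixAlg B p :=
  mem_cfc (fixAlg_cstar hB hp.1.star_eq) he f hf h0

theorem cc_le {B : Set (H →L[ℂ] H)} {p q : H →L[ℂ] H} (hp : IsProjectionOp p)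
    (hq : IsProjectionOp q) (h : IsCompactlyContained B p q) :
    ∃ a ∈ fixAlg B q, 0 ≤ a ∧ ‖a‖ ≤ 1 ∧ a * p = p := by
  obtain ⟨c, hc, a, ha, hpos, hn, hca⟩ := h
  rw [her_eq hq] at ha
  have ha0 := (ContinuousLinearMap.nonneg_iff_isPositive _).2 hpos
  refine ⟨a, ha, ha0, hn, ?_⟩
  have h1 := (proj_le_iff hp hc.1.1).1 hc.2.1
  have h2 : a * c = c := by
    have := congrArg star hca
    simpa [sa_of_nonneg ha0, hc.1.1.1.star_eq] using this
  rw [← h1, ← mul_assoc, h2]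

theorem sub_of_cule {B : Set (H →L[ℂ] H)} (hB : IsCStarSubalg B)
    (hsep : TopologicalSpace.IsSeparable B) (hnd : Nondegenerate B) {p q : H →L[ℂ] H}
    (hp : IsProjectionOp p) (hq : IsProjectionOp q) (h : CuLE B p q) : Sub B p q := by
  intro e he he0 ε hε
  have hsa : IsSelfAdjoint e := IsSelfAdjoint.of_nonneg he0
  set f : ℝ → ℝ := fun t => √(max 0 (t - ε / 2)) with hf
  set g : ℝ → ℝ := fun t => min 1 (max 0 (2 * t / ε)) with hg
  have hfc : Continuous f := by fun_prop
  have hgc : Continuous g := by fun_prop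
  have hf0 : f 0 = 0 := by
    simp only [hf]; rw [max_eq_left (by linarith), Real.sqrt_zero]
  have hg0 : g 0 = 0 := by simp [hg]
  set x := cfc f e
  set d := cfc g e
  have hx := cfc_fix_mem hB hp he f hfc hf0
  have hd := cfc_fix_mem hB hp he g hgc hg0
  have hxs : star x = x := star_cfc f e
  have hds : star d = d := star_cfc g e
  have hd0 : 0 ≤ d := cfc_nonneg fun t _ => by simp only [hg]; exact le_min zero_le_one (le_max_left _ _)
  have hd1 : ‖d‖ ≤ 1 := norm_cfc_bd he0 _ zero_le_one fun t _ _ => by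
    rw [abs_of_nonneg (le_min zero_le_one (le_max_left _ _))]; exact min_le_left _ _
  have hgf : ∀ t, g t * f t = f t := fun t => by
    by_cases ht : t ≤ ε / 2
    · have : f t = 0 := by simp only [hf]; rw [max_eq_left (by linarith), Real.sqrt_zero]
      simp [this]
    · have : g t = 1 := by
        simp only [hg]
        refine min_eq_left (le_max_of_le_right ?_)
        rw [le_div_iff₀ hε]; linarith [not_le.1 ht]
      rw [this, one_mul]
  have hdx : d * x = x := by
    simp only [d, x]
    rw [← cfc_mul g f e hgc.continuousOn hfc.continuousOn]
    congr 1; ext t; exact hgf t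
  have hxd : x * d = x := by have := congrArg star hdx; simpa [hxs, hds] using this
  obtain ⟨p', hpo, hpu, hun⟩ := exists_unit hsep (fixAlg_cstar hB hds) (fixAlg_sub B d)
  have hdp : d * p' = p' := by
    have := hun d 1 fun y hy => by rw [hy.2.1, one_mul]
    simpa using this
  have hcc : IsCompactlyContained B p' p :=
    cc_of hB hsep hnd hpo.1 (by rw [her_eq hp]; exact hd) hd0 hd1 hdp
  obtain ⟨q', hqo, hqc, v, hv, hvv, hvv', hva, -⟩ := h p' hpo hcc
  have hpx : p' * x = x := hpu x ⟨hx.1, hdx, hxd⟩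
  have hxp : x * p' = x := by have := congrArg star hpx; simpa [hxs, hpo.1.1.star_eq] using this
  obtain ⟨a, ha, ha0, -, haq⟩ := cc_le hqo.1 hq hqc
  have hqq : q * q' = q' := by rw [← haq, ← mul_assoc, ha.2.1]
  have hqv : q' * v = v := by
    have hpi : p' * p' = p' := hpo.1.2
    have : v * p' - v = 0 := by
      apply zero_of_sq'
      simp only [star_sub, star_mul, hpo.1.1.star_eq, sub_mul, mul_sub]
      simp only [← mul_assoc, hvv]
      simp only [mul_assoc, hvv]
      simp only [hpi]; simp
    rw [← hvv', mul_assoc, hvv]; exact sub_eq_zero.1 this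
  refine ⟨v * x, hva x ⟨hx.1, by rw [hpx, hxp]⟩, ?_, ?_⟩
  · rw [← hqv]; simp only [← mul_assoc, hqq]
  · have e1 : star (v * x) * (v * x) = x * x := by
      rw [star_mul, hxs, mul_assoc, ← mul_assoc (star v), hvv, hpx]
    have e2 : x * x - e = cfc (fun t => f t * f t - t) e := by
      simp only [x]
      rw [← cfc_mul f f e hfc.continuousOn hfc.continuousOn]
      rw [cfc_sub _ _ e (by fun_prop) (by fun_prop), cfc_id' ℝ e]
    rw [e1, e2]
    refine lt_of_le_of_lt (norm_cfc_bd he0 _ (c := ε / 2) (by linarith) fun t ht _ => ?_) (by linarith)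
    simp only [hf]
    rw [Real.mul_self_sqrt (le_max_left _ _), abs_le]
    rcases le_total 0 (t - ε / 2) with h | h
    · rw [max_eq_right h]; constructor <;> linarith
    · rw [max_eq_left h]; constructor <;> linarith


theorem net_finset {ι : Type} {le : ι → ι → Prop} {a : ι → H →L[ℂ] H} {p : H →L[ℂ] H} (hne : Nonempty ι)
    (ht : ∀ i j k, le i j → le j k → le i k) (hd : ∀ i j, ∃ k, le i k ∧ le j k)
    (hl : ∀ x : H, ∀ ε : ℝ, 0 < ε → ∃ i, ∀ j, le i j → ‖a j x - p x‖ < ε) {ε : ℝ} (hε : 0 < ε)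
    (F : Finset H) : ∃ i, ∀ x ∈ F, ∀ j, le i j → ‖a j x - p x‖ < ε := by
  classical
  induction F using Finset.induction_on with
  | empty => exact ⟨hne.some, by simp⟩
  | insert x F _ ih =>
    obtain ⟨i, hi⟩ := ih
    obtain ⟨i', hi'⟩ := hl x ε hε
    obtain ⟨k, hk1, hk2⟩ := hd i i'
    refine ⟨k, fun y hy j hj => ?_⟩
    rcases Finset.mem_insert.1 hy with rfl | hy
    · exact hi' j (ht _ _ _ hk2 hj)
    · exact hi y hy j (ht _ _ _ hk1 hj)

theorem cule_of_sub {B : Set (H →L[ℂ] H)} (hB : IsCStarSubalg B)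
    (hsep : TopologicalSpace.IsSeparable B) (hnd : Nondegenerate B) {p q : H →L[ℂ] H}
    (hp : IsProjectionOp p) (hq : IsProjectionOp q) (h : Sub B p q) : CuLE B p q := by
  intro p' hpo hcc
  obtain ⟨e, he, he0, he1, hep⟩ := cc_le hpo.1 hp hcc
  obtain ⟨V, hV, hqV, hVe⟩ := h e he he0 (1 / 2) (by norm_num)
  obtain ⟨W, hW, hWW, hWT⟩ := exact_of_approx hB he.1 he0 hV hVe
  have hqW : q * W = W := hWT q hqV
  have hW1 : ‖W‖ ≤ 1 := norm_le_one_of_star (by rw [hWW]; exact norm_phi_le he0 he1)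
  have hps : star p' = p' := hpo.1.1.star_eq
  have hpi : p' * p' = p' := hpo.1.2
  have hWp : star W * W * p' = p' := by rw [hWW]; exact phi_fix he0 hep
  have hpW : p' * (star W * W) = p' := by
    have := congrArg star hWp; simpa [hps, mul_assoc] using this
  obtain ⟨g1, g2, g3, g4, g5, g6⟩ := id hB
  have hsW := g5 W hW
  have hpWW : ∀ y, p' * (star W * (W * y)) = p' * y := fun y => by
    rw [← mul_assoc (star W), ← mul_assoc, hpW]
  have hWWp : ∀ y, star W * (W * (p' * y)) = p' * y := fun y => by
    rw [← mul_assoc, ← mul_assoc, hWp]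
  have hppy : ∀ y, p' * (p' * y) = p' * y := fun y => by rw [← mul_assoc, hpi]
  have hqp : IsProjectionOp (W * p' * star W) := by
    refine ⟨?_, ?_⟩
    · show star _ = _
      simp [hps, mul_assoc]
    · show _ * _ = _
      simp only [mul_assoc, hpWW, hppy]
  obtain ⟨ι, le, a, hne, hr, ht, hd, haB, hpos, hm, hl⟩ := open_net hpo
  refine ⟨W * p' * star W, ⟨hqp, ι, le, fun i => W * a i * star W, hne, hr, ht, hd, ?_, ?_, ?_, ?_⟩,
    ?_, W * p', ?_, ?_, ?_, ?_, ?_⟩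
  · exact fun i => g4 _ (g4 _ hW _ (haB i).1) _ hsW
  · exact fun i => (ContinuousLinearMap.nonneg_iff_isPositive _).1
      (star_right_conjugate_nonneg (hpos i) W)
  · intro i j hij
    have : W * a i * star W ≤ W * a j * star W := star_right_conjugate_le_conjugate (hm i j hij) W
    exact this
  · intro x ε hε
    obtain ⟨i, hi⟩ := hl (star W x) ε hε
    refine ⟨i, fun j hj => ?_⟩
    have e1 : (W * a j * star W) x - (W * p' * star W) x = W (a j (star W x) - p' (star W x)) := by
      simp
    show ‖(W * a j * star W) x - (W * p' * star W) x‖ < ε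
    rw [e1]
    calc _ ≤ ‖W‖ * ‖a j (star W x) - p' (star W x)‖ := W.le_opNorm _
      _ ≤ 1 * ‖a j (star W x) - p' (star W x)‖ := by gcongr
      _ < ε := by rw [one_mul]; exact hi j hj
  · refine cc_of hB hsep hnd hqp (a := W * star W) ⟨g4 _ hW _ hsW, ?_⟩ (mul_star_self_nonneg W) ?_ ?_
    · have : star W * q = star W := by
        have := congrArg star hqW; simpa [hq.1.star_eq] using this
      rw [← mul_assoc, hqW, mul_assoc, this]
    · rw [CStarRing.norm_self_mul_star]; nlinarith [norm_nonneg W]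
    · simp only [mul_assoc, hWWp]
  · intro ε hε F
    obtain ⟨i, hi⟩ := net_finset hne ht hd hl hε F
    refine ⟨W * a i, g4 _ hW _ (haB i).1, fun x hx => ?_⟩
    have e1 : (W * p') x - (W * a i) x = - W (a i x - p' x) := by simp
    rw [e1, norm_neg]
    calc _ ≤ ‖W‖ * ‖a i x - p' x‖ := W.le_opNorm _
      _ ≤ 1 * ‖a i x - p' x‖ := by gcongr
      _ < ε := by rw [one_mul]; exact hi x hx i (hr i)
  · rw [star_mul, hps]; simp only [mul_assoc, hpWW, hpi]
  · rw [star_mul, hps]; simp only [mul_assoc, hppy]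
  · intro x hx
    rw [her_eq hpo.1] at hx
    rw [mul_assoc, hx.2.1]; exact g4 _ hW _ hx.1
  · intro x hx
    rw [her_eq hqp] at hx
    have : star (W * p') * x = star W * x := by
      rw [star_mul, hps]
      conv_rhs => rw [← hx.2.1]
      simp only [mul_assoc, hWWp]
    rw [this]; exact g4 _ hsW _ hx.1

theorem exists_sqrt {B : Set (H →L[ℂ] H)} (hB : IsCStarSubalg B) {p e : H →L[ℂ] H}
    (hp : IsProjectionOp p) (he : e ∈ fixAlg B p) (he0 : 0 ≤ e) :
    ∃ b ∈ fixAlg B p, 0 ≤ b ∧ star b = b ∧ b * b = e := by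
  have hsa : IsSelfAdjoint e := IsSelfAdjoint.of_nonneg he0
  refine ⟨cfc Real.sqrt e, cfc_fix_mem hB hp he _ Real.continuous_sqrt Real.sqrt_zero,
    cfc_nonneg fun t _ => Real.sqrt_nonneg t, star_cfc _ e, ?_⟩
  rw [← cfc_mul Real.sqrt Real.sqrt e Real.continuous_sqrt.continuousOn Real.continuous_sqrt.continuousOn]
  conv_rhs => rw [← cfc_id' ℝ e]
  exact cfc_congr fun t ht => Real.mul_self_sqrt (spectrum_nonneg_of_nonneg he0 ht)

theorem Sub.rfl' {B : Set (H →L[ℂ] H)} (hB : IsCStarSubalg B) {p : H →L[ℂ] H}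
    (hp : IsProjectionOp p) : Sub B p p := by
  intro e he he0 ε hε
  obtain ⟨b, hb, -, hbs, hbb⟩ := exists_sqrt hB hp he he0
  exact ⟨b, hb.1, hb.2.1, by simpa [hbs, hbb] using hε⟩

theorem Sub.trans' {B : Set (H →L[ℂ] H)} (hB : IsCStarSubalg B) {p q r : H →L[ℂ] H}
    (hp : IsProjectionOp p) (hq : IsProjectionOp q) (h1 : Sub B p q) (h2 : Sub B q r) :
    Sub B p r := by
  intro e he he0 ε hε
  obtain ⟨b, hb, hb0, hbs, hbb⟩ := exists_sqrt hB hp he he0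
  obtain ⟨g1, g2, g3, g4, g5, g6⟩ := id hB
  set δ := min 1 (ε / (3 * ‖b‖ + 3)) with hδ
  have hδ0 : 0 < δ := by positivity
  have hδ1 : δ ≤ 1 := min_le_left _ _
  have hδ2 : δ * (3 * ‖b‖ + 3) ≤ ε := by
    rw [← le_div_iff₀ (by positivity)]; exact min_le_right _ _
  obtain ⟨W, hW, hqW, hWb⟩ := h1 b hb hb0 δ hδ0
  have hWq : star W * q = star W := by
    have := congrArg star hqW; simpa [hq.1.star_eq] using this
  obtain ⟨V, hV, hrV, hVW⟩ := h2 (W * star W) ⟨g4 _ hW _ (g5 _ hW), by rw [← mul_assoc, hqW],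
    by rw [mul_assoc, hWq]⟩ (mul_star_self_nonneg W) δ hδ0
  refine ⟨V * W, g4 _ hV _ hW, by rw [← mul_assoc, hrV], ?_⟩
  have e1 : star (V * W) * (V * W) - e = star W * (star V * V - W * star W) * W +
      ((star W * W - b) * (star W * W) + b * (star W * W - b)) := by
    rw [← hbb, star_mul]; noncomm_ring
  have n0 : ‖star W * W‖ ≤ ‖b‖ + 1 := by
    have := norm_add_le (star W * W - b) b
    rw [sub_add_cancel] at this; linarith
  have n0' : ‖W‖ * ‖W‖ ≤ ‖b‖ + 1 := by rwa [CStarRing.norm_star_mul_self] at n0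
  have n1 : ‖star W * (star V * V - W * star W) * W‖ ≤ (‖b‖ + 1) * δ := by
    calc _ ≤ ‖star W‖ * ‖star V * V - W * star W‖ * ‖W‖ := by
          refine (norm_mul_le _ _).trans ?_
          gcongr; exact norm_mul_le _ _
      _ = ‖W‖ * ‖W‖ * ‖star V * V - W * star W‖ := by rw [norm_star]; ring
      _ ≤ _ := by gcongr
  have n2 : ‖(star W * W - b) * (star W * W)‖ ≤ δ * (‖b‖ + 1) := by
    refine (norm_mul_le _ _).trans ?_; gcongr
  have n3 : ‖b * (star W * W - b)‖ ≤ ‖b‖ * δ := by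
    refine (norm_mul_le _ _).trans ?_; gcongr
  rw [e1]
  have := norm_add_le (star W * (star V * V - W * star W) * W)
    ((star W * W - b) * (star W * W) + b * (star W * W - b))
  have := norm_add_le ((star W * W - b) * (star W * W)) (b * (star W * W - b))
  nlinarith

theorem norm_one_sub_le {u : H →L[ℂ] H} (h : ‖u‖ ≤ 1) : ‖1 - u‖ ≤ 2 := by
  have h3 : ‖(1 : H →L[ℂ] H)‖ ≤ 1 := ContinuousLinearMap.norm_id_le
  linarith [norm_sub_le 1 u]

theorem AU.lim' {B : Set (H →L[ℂ] H)} (hB : IsCStarSubalg B) {q : H →L[ℂ] H}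
    (hq : IsProjectionOp q) {U : ℕ → H →L[ℂ] H} (hU : AU (fixAlg B q) U) {V : H →L[ℂ] H}
    (hV : V ∈ B) (hqV : q * V = V) : Tendsto (fun k => U k * V) atTop (𝓝 V) := by
  obtain ⟨g1, g2, g3, g4, g5, g6⟩ := id hB
  have hVq : star V * q = star V := by
    have := congrArg star hqV; simpa [hq.1.star_eq] using this
  have h1 := hU.lim (V * star V) ⟨g4 _ hV _ (g5 _ hV), by rw [← mul_assoc, hqV],
    by rw [mul_assoc, hVq]⟩
  rw [Metric.tendsto_atTop] at h1 ⊢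
  intro ε hε
  obtain ⟨N, hN⟩ := h1 (ε ^ 2 / 2) (by positivity)
  refine ⟨N, fun n hn => ?_⟩
  have h2 := hN n hn
  rw [dist_eq_norm] at h2 ⊢
  have hs : star (U n) = U n := sa_of_nonneg (hU.nonneg n)
  have e1 : (U n * V - V) * star (U n * V - V) = - ((U n * (V * star V) - V * star V) * (1 - U n)) := by
    simp only [star_sub, star_mul, hs]; noncomm_ring
  have e2 : ‖U n * V - V‖ * ‖U n * V - V‖ ≤ ‖U n * (V * star V) - V * star V‖ * 2 := by
    rw [← CStarRing.norm_self_mul_star, e1, norm_neg]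
    refine (norm_mul_le _ _).trans ?_
    gcongr
    exact norm_one_sub_le (hU.norm_le n)
  nlinarith [norm_nonneg (U n * V - V)]

theorem lemQ {B : Set (H →L[ℂ] H)} (hB : IsCStarSubalg B) {p q e : H →L[ℂ] H}
    (hq : IsProjectionOp q) {U : ℕ → H →L[ℂ] H} (hU : AU (fixAlg B q) U) (h : Sub B p q)
    (he : e ∈ fixAlg B p) (he0 : 0 ≤ e) {ε : ℝ} (hε : 0 < ε) :
    ∃ K, ∀ k, K ≤ k → ∃ V ∈ B, U k * V = V ∧ ‖star V * V - e‖ < ε := by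
  obtain ⟨V, hV, hqV, hVe⟩ := h e he he0 ε hε
  have h1 := hU.lim' hB hq hV hqV
  have h2 : Tendsto (fun k => ‖star (U k * V) * (U k * V) - e‖) atTop (𝓝 ‖star V * V - e‖) :=
    ((h1.star.mul h1).sub_const e).norm
  obtain ⟨k, hk⟩ := (h2.eventually (gt_mem_nhds hVe)).exists
  exact ⟨k + 1, fun l hl => ⟨U k * V, hB.2.2.2.1 _ (hU.mem k).1 _ hV,
    by rw [← mul_assoc, hU.ai.lt hl], hk⟩⟩

theorem lemStep {B : Set (H →L[ℂ] H)} (hB : IsCStarSubalg B) {p q : H →L[ℂ] H}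
    (hq : IsProjectionOp q) {U U' : ℕ → H →L[ℂ] H} (hU' : AU (fixAlg B p) U')
    (hU : AU (fixAlg B q) U) (h : Sub B p q) (n : ℕ) :
    ∃ K, ∀ k, K ≤ k → ∃ W ∈ B, ‖W‖ ≤ 1 ∧ star W * W * U' n = U' n ∧ U k * W = W := by
  obtain ⟨K, hK⟩ := lemQ hB hq hU h (hU'.mem (n + 1)) (hU'.nonneg _) (ε := 1 / 2) (by norm_num)
  refine ⟨K, fun k hk => ?_⟩
  obtain ⟨V, hV, hUV, hVe⟩ := hK k hk
  obtain ⟨W, hW, hWW, hWT⟩ := exact_of_approx hB (hU'.mem (n + 1)).1 (hU'.nonneg _) hV hVe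
  refine ⟨W, hW, norm_le_one_of_star ?_, ?_, hWT _ hUV⟩
  · rw [hWW]; exact norm_phi_le (hU'.nonneg _) (hU'.norm_le _)
  · rw [hWW]; exact phi_fix (hU'.nonneg _) (hU'.succ n)


theorem exists_data {B : Set (H →L[ℂ] H)} (hB : IsCStarSubalg B) {p : ℕ → H →L[ℂ] H}
    (hp : ∀ n, IsProjectionOp (p n)) {U : ℕ → ℕ → H →L[ℂ] H} (hU : ∀ n, AU (fixAlg B (p n)) (U n))
    (hS : ∀ m n, m ≤ n → Sub B (p m) (p n)) :
    ∃ u W : ℕ → H →L[ℂ] H, (∀ n, u n ∈ fixAlg B (p n)) ∧ (∀ n, 0 ≤ u n) ∧ (∀ n, ‖u n‖ ≤ 1) ∧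
      (∀ n, W n ∈ B) ∧ (∀ n, ‖W n‖ ≤ 1) ∧ (∀ n, star (W n) * W n * u n = u n) ∧
      (∀ n, u (n + 1) * W n = W n) ∧
      ∀ m j n, m ≤ n + 1 → j ≤ n + 1 →
        ∃ V ∈ B, u (n + 1) * V = V ∧ ‖star V * V - U m j‖ < 1 / ((n : ℝ) + 1) := by
  have hK : ∀ n k, ∃ K, ∀ l, K ≤ l → ∃ W ∈ B, ‖W‖ ≤ 1 ∧ star W * W * U n k = U n k ∧
      U (n + 1) l * W = W := fun n k =>
    lemStep hB (hp (n + 1)) (hU n) (hU (n + 1)) (hS n (n + 1) n.le_succ) k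
  choose K hK using hK
  have hκ : ∀ m j n, ∃ K, m ≤ n + 1 → ∀ k, K ≤ k →
      ∃ V ∈ B, U (n + 1) k * V = V ∧ ‖star V * V - U m j‖ < 1 / ((n : ℝ) + 1) := by
    intro m j n
    by_cases h : m ≤ n + 1
    · obtain ⟨K, hK⟩ := lemQ hB (hp (n + 1)) (hU (n + 1)) (hS m (n + 1) h) ((hU m).mem j)
        ((hU m).nonneg j) (ε := 1 / ((n : ℝ) + 1)) (by positivity)
      exact ⟨K, fun _ => hK⟩
    · exact ⟨0, fun h' => absurd h' h⟩
  choose κ hκ using hκ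
  let kk : ℕ → ℕ := fun n => Nat.rec 0 (fun n k => max (K n k)
    ((Finset.range (n + 2) ×ˢ Finset.range (n + 2)).sup fun x => κ x.1 x.2 n)) n
  have hkk : ∀ n, kk (n + 1) = max (K n (kk n))
    ((Finset.range (n + 2) ×ˢ Finset.range (n + 2)).sup fun x => κ x.1 x.2 n) := fun n => rfl
  have hW : ∀ n, ∃ W ∈ B, ‖W‖ ≤ 1 ∧ star W * W * U n (kk n) = U n (kk n) ∧
      U (n + 1) (kk (n + 1)) * W = W := fun n => hK n (kk n) _ (by rw [hkk]; exact le_max_left _ _)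
  choose W hW1 hW2 hW3 hW4 using hW
  refine ⟨fun n => U n (kk n), W, fun n => (hU n).mem _, fun n => (hU n).nonneg _,
    fun n => (hU n).norm_le _, hW1, hW2, hW3, hW4, fun m j n hm hj => hκ m j n hm _ ?_⟩
  rw [hkk]
  refine le_max_of_le_right ?_
  exact Finset.le_sup (f := fun x : ℕ × ℕ => κ x.1 x.2 n) (b := (m, j))
    (by simp only [Finset.mem_product, Finset.mem_range]; omega)

theorem mult_cstar {B : Set (H →L[ℂ] H)} (hB : IsCStarSubalg B) : IsCStarSubalg (multiplierSet B) := by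
  obtain ⟨g1, g2, g3, g4, g5, g6⟩ := hB
  refine ⟨?_, ?_, ?_, ?_, ?_, ?_⟩
  · intro a ha; simpa using g1
  · intro x hx y hy a ha
    rw [add_mul, mul_add]
    exact ⟨g2 _ (hx a ha).1 _ (hy a ha).1, g2 _ (hx a ha).2 _ (hy a ha).2⟩
  · intro c x hx a ha
    rw [smul_mul_assoc, mul_smul_comm]
    exact ⟨g3 c _ (hx a ha).1, g3 c _ (hx a ha).2⟩
  · intro x hx y hy a ha
    rw [mul_assoc, ← mul_assoc a]
    exact ⟨(hx _ (hy a ha).1).1, (hy _ (hx a ha).2).2⟩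
  · intro x hx a ha
    have h := hx (star a) (g5 a ha)
    refine ⟨?_, ?_⟩
    · have := g5 _ h.2; simpa using this
    · have := g5 _ h.1; simpa using this
  · have : multiplierSet B = ⋂ a ∈ B, ((fun x => x * a) ⁻¹' B ∩ (fun x => a * x) ⁻¹' B) := by
      ext x; simp [multiplierSet]
    rw [this]
    refine isClosed_biInter fun a _ => ?_
    exact (g6.preimage (by fun_prop)).inter (g6.preimage (by fun_prop))

theorem exists_defect {B : Set (H →L[ℂ] H)} (hB : IsCStarSubalg B) {W : H →L[ℂ] H} (hW : W ∈ B)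
    (h1 : ‖W‖ ≤ 1) : ∃ Q ∈ multiplierSet B, star Q = Q ∧ Q * Q = 1 - W * star W := by
  have hM := mult_cstar hB
  obtain ⟨g1, g2, g3, g4, g5, g6⟩ := id hM
  have hone : (1 : H →L[ℂ] H) ∈ multiplierSet B := fun a ha => by simpa using ha
  have hWM : W ∈ multiplierSet B := fun a ha => ⟨hB.2.2.2.1 _ hW _ ha, hB.2.2.2.1 _ ha _ hW⟩
  have hp1 : IsProjectionOp (1 : H →L[ℂ] H) := ⟨star_one _, one_mul _⟩
  have hm : (1 - W * star W) ∈ multiplierSet B := by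
    have : 1 - W * star W = 1 + (-1 : ℂ) • (W * star W) := by simp [sub_eq_add_neg]
    rw [this]
    exact g2 _ hone _ (g3 _ _ (g4 _ hWM _ (g5 _ hWM)))
  have hn : 0 ≤ 1 - W * star W := by
    rw [sub_nonneg]
    refine (CStarAlgebra.norm_le_one_iff_of_nonneg _ (mul_star_self_nonneg W)).1 ?_
    rw [CStarRing.norm_self_mul_star]; nlinarith [norm_nonneg W]
  obtain ⟨b, hb, -, hbs, hbb⟩ := exists_sqrt hM hp1 (e := 1 - W * star W) ⟨hm, one_mul _, mul_one _⟩ hn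
  exact ⟨b, hb.1, hbs, hbb⟩

/-- the isometries carrying the sequence to an increasing one -/
noncomputable def Zs (s W Q : ℕ → H →L[ℂ] H) : ℕ → H →L[ℂ] H
  | 0 => s 0
  | n + 1 => Zs s W Q n * star (W n) + s (n + 1) * Q n

theorem exists_tower {B : Set (H →L[ℂ] H)} (hB : IsCStarSubalg B) (hst : IsStableAlg B)
    {u W : ℕ → H →L[ℂ] H} (hu : ∀ n, u n ∈ B) (hu0 : ∀ n, 0 ≤ u n) (hu1 : ∀ n, ‖u n‖ ≤ 1)
    (hW : ∀ n, W n ∈ B) (hW1 : ∀ n, ‖W n‖ ≤ 1) (hWu : ∀ n, star (W n) * W n * u n = u n)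
    (huW : ∀ n, u (n + 1) * W n = W n) :
    ∃ (Z : ℕ → H →L[ℂ] H) (S : H →L[ℂ] H), IsOpenProjection B S ∧ (∀ n, Z n ∈ multiplierSet B) ∧
      (∀ n, star (Z n) * Z n = 1) ∧ (∀ n, S * (Z n * u n) = Z n * u n) ∧
      ∀ b ∈ B, S * b = b → Tendsto (fun n => Z n * u n * star (Z n) * b) atTop (𝓝 b) := by
  obtain ⟨s, hsM, hs1, hs2, hst⟩ := hst
  have hM := mult_cstar hB
  obtain ⟨g1, g2, g3, g4, g5, g6⟩ := id hM
  choose Q hQM hQs hQQ using fun n => exists_defect hB (hW n) (hW1 n)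
  have hWM : ∀ n, W n ∈ multiplierSet B := fun n a ha =>
    ⟨hB.2.2.2.1 _ (hW n) _ ha, hB.2.2.2.1 _ ha _ (hW n)⟩
  set Z := Zs s W Q with hZ
  have hZs : ∀ n, Z (n + 1) = Z n * star (W n) + s (n + 1) * Q n := fun n => rfl
  have hZM : ∀ n, Z n ∈ multiplierSet B := by
    intro n
    induction n with
    | zero => exact hsM 0
    | succ n ih => rw [hZs]; exact g2 _ (g4 _ ih _ (g5 _ (hWM n))) _ (g4 _ (hsM _) _ (hQM n))
  have F1 : ∀ n k, n < k → star (s k) * Z n = 0 := by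
    intro n
    induction n with
    | zero => intro k hk; exact hs2 k 0 (by omega)
    | succ n ih =>
      intro k hk
      rw [hZs, mul_add, ← mul_assoc, ← mul_assoc, ih k (by omega), hs2 k (n + 1) (by omega)]; simp
  have F1' : ∀ n k, n < k → star (Z n) * s k = 0 := fun n k h => by
    have := congrArg star (F1 n k h); simpa using this
  have F2 : ∀ n, star (Z n) * Z n = 1 := by
    intro n
    induction n with
    | zero => exact hs1 0
    | succ n ih =>
      have a1 := F1 n (n + 1) (by omega)
      have a2 := F1' n (n + 1) (by omega)
      have a3 := hs1 (n + 1)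
      rw [hZs]
      simp only [star_add, star_mul, star_star, hQs]
      calc _ = W n * (star (Z n) * Z n) * star (W n) + W n * (star (Z n) * s (n + 1)) * Q n
            + Q n * (star (s (n + 1)) * Z n) * star (W n)
            + Q n * (star (s (n + 1)) * s (n + 1)) * Q n := by noncomm_ring
        _ = 1 := by rw [ih, a1, a2, a3]; simp [hQQ]
  have F3 : ∀ n x, star (W n) * W n * x = x → Z (n + 1) * (W n * x) = Z n * x := by
    intro n x hx
    have h0 : Q n * (W n * x) = 0 := by
      apply zero_of_sq'
      simp only [star_mul, hQs]
      calc _ = star x * star (W n) * (Q n * Q n) * (W n * x) := by noncomm_ring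
        _ = star x * (star (W n) * W n * x) -
            star x * (star (W n) * W n * (star (W n) * W n * x)) := by rw [hQQ]; noncomm_ring
        _ = 0 := by rw [hx, hx, sub_self]
    rw [hZs, add_mul, mul_assoc (s (n + 1)), h0, mul_zero, add_zero, mul_assoc,
      ← mul_assoc (star (W n)), hx]
  have hZ1 : ∀ n, ‖Z n‖ ≤ 1 := fun n => norm_le_one_of_star (by
    rw [F2]; exact ContinuousLinearMap.norm_id_le)
  set A : ℕ → H →L[ℂ] H := fun n => Z n * u n * star (Z n) with hA
  have hAB : ∀ n, A n ∈ B := fun n => (g5 _ (hZM n) _ (hZM n _ (hu n)).1).2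
  have hAZ : ∀ n, A n * Z n = Z n * u n := fun n => by
    simp only [hA]; rw [mul_assoc, F2, mul_one]
  have hstep : ∀ n y, A (n + 1) * (Z n * (u n * y)) = Z n * (u n * y) := by
    intro n y
    have hx : star (W n) * W n * (u n * y) = u n * y := by rw [← mul_assoc, hWu]
    rw [← F3 n _ hx, ← mul_assoc (A (n + 1)), hAZ, mul_assoc, ← mul_assoc (u (n + 1)), huW]
  have hAI : AI A := by
    refine ⟨fun n => star_right_conjugate_nonneg (hu0 n) _, fun n => ?_, fun n => ?_⟩
    · calc ‖A n‖ ≤ ‖Z n‖ * ‖u n‖ * ‖star (Z n)‖ := by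
            refine (norm_mul_le _ _).trans ?_
            gcongr; exact norm_mul_le _ _
        _ ≤ 1 * 1 * 1 := by
            rw [norm_star]; gcongr
            · exact hZ1 n
            · exact hu1 n
            · exact hZ1 n
        _ = 1 := by norm_num
    · have := hstep n (star (Z n))
      simpa only [hA, mul_assoc] using this
  obtain ⟨S, hSp, hSl, hSA⟩ := hAI.exists_lim
  refine ⟨Z, S, isOpen_of_AI hAI hAB hSp hSl, hZM, F2, fun n => ?_, fun b hb hSb => ?_⟩
  · rw [← hAZ, ← mul_assoc, hSA]
  have F4 : ∀ n k, k ≤ n → star (Z (n + 1)) * s k = W n * (star (Z n) * s k) := by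
    intro n k hk
    rw [hZs]
    simp only [star_add, star_mul, star_star, hQs, add_mul, mul_assoc]
    rw [hs2 (n + 1) k (by omega)]; simp
  have F5 : ∀ n k, k < n → u n * (star (Z n) * s k) = star (Z n) * s k := by
    intro n k hk
    obtain ⟨n, rfl⟩ : ∃ m, n = m + 1 := ⟨n - 1, by omega⟩
    rw [F4 n k (by omega), ← mul_assoc, huW]
  have F6 : ∀ n k, k < n → A (n + 1) * s k = A n * s k := by
    intro n k hk
    have hx : star (W n) * W n * (star (Z n) * s k) = star (Z n) * s k := by
      rw [← F5 n k hk, ← mul_assoc _ (u n), hWu]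
    have l1 : A (n + 1) * s k = Z (n + 1) * (u (n + 1) * (star (Z (n + 1)) * s k)) := by
      simp only [hA, mul_assoc]
    have l2 : A n * s k = Z n * (u n * (star (Z n) * s k)) := by
      simp only [hA, mul_assoc]
    rw [l1, l2, F5 (n + 1) k (by omega), F5 n k hk, F4 n k hk.le, F3 n _ hx]
  have F7 : ∀ N k, k < N → S * s k = A N * s k := by
    intro N k hk
    have hc : ∀ M, N ≤ M → A M * s k = A N * s k := by
      intro M hM
      induction M, hM using Nat.le_induction with
      | base => rfl
      | succ M hM ih => rw [F6 M k (by omega), ih]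
    ext x
    refine tendsto_nhds_unique (hSl (s k x)) ?_
    refine tendsto_const_nhds.congr' ?_
    filter_upwards [eventually_ge_atTop N] with M hM
    have := congrArg (fun T : H →L[ℂ] H => T x) (hc M hM)
    simpa using this.symm
  set P : ℕ → H →L[ℂ] H := fun N => ∑ k ∈ Finset.range N, s k * star (s k) with hP
  have F8 : ∀ N, S * P N = A N * P N := by
    intro N
    simp only [hP, Finset.mul_sum]
    refine Finset.sum_congr rfl fun k hk => ?_
    rw [← mul_assoc, ← mul_assoc, F7 N k (Finset.mem_range.1 hk)]
  rw [Metric.tendsto_atTop]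
  intro ε hε
  obtain ⟨N, hN⟩ := hst b hb (ε / (‖S‖ + 1)) (by positivity)
  refine ⟨N, fun n hn => ?_⟩
  have h1 : ‖P n * b - 1 * b‖ < ε / (‖S‖ + 1) := (hN n hn).1
  have e1 : A n * b - b = (S - A n) * (P n * b - 1 * b) := by
    have : (S - A n) * (P n * b - 1 * b) = (S * P n) * b - A n * P n * b - S * b + A n * b := by
      noncomm_ring
    rw [this, F8, hSb]; abel
  rw [dist_eq_norm]
  show ‖A n * b - b‖ < ε
  rw [e1]
  calc _ ≤ ‖S - A n‖ * ‖P n * b - 1 * b‖ := norm_mul_le _ _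
    _ ≤ (‖S‖ + 1) * ‖P n * b - 1 * b‖ := by
        gcongr; exact (norm_sub_le _ _).trans (by gcongr; exact hAI.norm_le n)
    _ < (‖S‖ + 1) * (ε / (‖S‖ + 1)) := by gcongr
    _ = ε := by field_simp


theorem norm_conj_le {b T : H →L[ℂ] H} {δ : ℝ} (h : ‖T‖ ≤ δ) : ‖b * T * b‖ ≤ δ * (‖b‖ * ‖b‖) := by
  calc _ ≤ ‖b‖ * ‖T‖ * ‖b‖ := by
        refine (norm_mul_le _ _).trans ?_
        gcongr; exact norm_mul_le _ _
    _ ≤ ‖b‖ * δ * ‖b‖ := by gcongr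
    _ = _ := by ring

theorem main_aux
    (B : Set (H →L[ℂ] H)) (hB : IsCStarSubalg B)
    (hsep : TopologicalSpace.IsSeparable B) (hnd : Nondegenerate B)
    (hstable : IsStableAlg B)
    (p : ℕ → H →L[ℂ] H) (hopen : ∀ n, IsOpenProjection B (p n))
    (hsub : ∀ n, CuLE B (p n) (p (n + 1))) :
    ∃ s : H →L[ℂ] H, IsOpenProjection B s ∧ (∀ n, CuLE B (p n) s) ∧
      ∀ r, IsOpenProjection B r → (∀ n, CuLE B (p n) r) → CuLE B s r := by
  have hp : ∀ n, IsProjectionOp (p n) := fun n => (hopen n).1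
  obtain ⟨g1, g2, g3, g4, g5, g6⟩ := id hB
  have hS : ∀ m n, m ≤ n → Sub B (p m) (p n) := by
    intro m n hmn
    induction n, hmn using Nat.le_induction with
    | base => exact Sub.rfl' hB (hp m)
    | succ n hn ih =>
      exact ih.trans' hB (hp m) (hp n) (sub_of_cule hB hsep hnd (hp n) (hp (n + 1)) (hsub n))
  choose U hU using fun n => exists_AU (fixAlg_cstar hB (hp n).1.star_eq)
    (hsep.mono (fixAlg_sub B (p n)))
  obtain ⟨u, W, hu, hu0, hu1, hW, hW1, hWu, huW, hV⟩ := exists_data hB hp hU hS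
  obtain ⟨Z, S, hSo, hZM, hZ1, hSZ, hlim⟩ :=
    exists_tower hB hstable (fun n => (hu n).1) hu0 hu1 hW hW1 hWu huW
  refine ⟨S, hSo, fun m => ?_, fun r hr hpr => ?_⟩
  · refine cule_of_sub hB hsep hnd (hp m) hSo.1 ?_
    intro e he he0 ε hε
    obtain ⟨b, hb, hb0, hbs, hbb⟩ := exists_sqrt hB (hp m) he he0
    have h1 : Tendsto (fun j => ‖b * (U m j * b) - e‖) atTop (𝓝 ‖b * b - e‖) :=
      ((((hU m).lim b hb).const_mul b).sub_const e).norm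
    rw [hbb, sub_self, norm_zero] at h1
    obtain ⟨j, hj⟩ := (h1.eventually (gt_mem_nhds (half_pos hε))).exists
    have h2 : Tendsto (fun n : ℕ => 1 / ((n : ℝ) + 1) * (‖b‖ * ‖b‖)) atTop (𝓝 (0 * (‖b‖ * ‖b‖))) :=
      tendsto_one_div_add_atTop_nhds_zero_nat.mul_const _
    rw [zero_mul] at h2
    obtain ⟨n, hn, hn2⟩ := ((h2.eventually (gt_mem_nhds (half_pos hε))).and
      (eventually_ge_atTop (max m j))).exists
    obtain ⟨V, hVB, huV, hVU⟩ := hV m j n (by omega) (by omega)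
    refine ⟨Z (n + 1) * (V * b), (hZM _ _ (g4 _ hVB _ hb.1)).1, ?_, ?_⟩
    · have : Z (n + 1) * (V * b) = Z (n + 1) * u (n + 1) * (V * b) := by
        rw [mul_assoc, ← mul_assoc (u (n + 1)), huV]
      rw [this, ← mul_assoc, hSZ]
    · have e1 : star (Z (n + 1) * (V * b)) * (Z (n + 1) * (V * b)) - e =
          b * (star V * V - U m j) * b + (b * (U m j * b) - e) := by
        have : star (Z (n + 1) * (V * b)) * (Z (n + 1) * (V * b)) = b * (star V * V) * b := by
          simp only [star_mul, hbs]
          calc _ = b * star V * (star (Z (n + 1)) * Z (n + 1)) * (V * b) := by noncomm_ring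
            _ = _ := by rw [hZ1]; noncomm_ring
        rw [this]; noncomm_ring
      rw [e1]
      have := norm_conj_le (b := b) hVU.le
      have := norm_add_le (b * (star V * V - U m j) * b) (b * (U m j * b) - e)
      linarith
  · refine cule_of_sub hB hsep hnd hSo.1 hr.1 ?_
    intro e he he0 ε hε
    obtain ⟨b, hb, hb0, hbs, hbb⟩ := exists_sqrt hB hSo.1 he he0
    have h1 : Tendsto (fun n => ‖b * (Z n * u n * star (Z n) * b) - e‖) atTop (𝓝 ‖b * b - e‖) :=
      (((hlim b hb.1 hb.2.1).const_mul b).sub_const e).norm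
    rw [hbb, sub_self, norm_zero] at h1
    obtain ⟨n, hn⟩ := (h1.eventually (gt_mem_nhds (half_pos hε))).exists
    have hδ : 0 < ε / (2 * (‖b‖ * ‖b‖ + 1)) := by positivity
    obtain ⟨V, hVB, hrV, hVu⟩ := sub_of_cule hB hsep hnd (hp n) hr.1 (hpr n) (u n) (hu n) (hu0 n) _ hδ
    have hZ2 : ‖Z n‖ ≤ 1 := norm_le_one_of_star (by
      rw [hZ1]; exact ContinuousLinearMap.norm_id_le)
    refine ⟨V * (star (Z n) * b), g4 _ hVB _
      ((mult_cstar hB).2.2.2.2.1 _ (hZM n) _ hb.1).1, by rw [← mul_assoc, hrV], ?_⟩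
    have e1 : star (V * (star (Z n) * b)) * (V * (star (Z n) * b)) - e =
        b * (Z n * (star V * V - u n) * star (Z n)) * b + (b * (Z n * u n * star (Z n) * b) - e) := by
      simp only [star_mul, star_star, hbs]; noncomm_ring
    have e2 : ‖Z n * (star V * V - u n) * star (Z n)‖ ≤ ε / (2 * (‖b‖ * ‖b‖ + 1)) := by
      calc _ ≤ ‖Z n‖ * ‖star V * V - u n‖ * ‖star (Z n)‖ := by
            refine (norm_mul_le _ _).trans ?_
            gcongr; exact norm_mul_le _ _
        _ ≤ 1 * ‖star V * V - u n‖ * 1 := by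
            rw [norm_star]; gcongr
        _ ≤ _ := by linarith
    rw [e1]
    have h3 := norm_conj_le (b := b) e2
    have h4 : ε / (2 * (‖b‖ * ‖b‖ + 1)) * (‖b‖ * ‖b‖) ≤ ε / 2 := by
      rw [div_mul_eq_mul_div, div_le_div_iff₀ (by positivity) (by norm_num)]
      nlinarith
    have := norm_add_le (b * (Z n * (star V * V - u n) * star (Z n)) * b)
      (b * (Z n * u n * star (Z n) * b) - e)
    linarith


end helpers

/-- **Statement 12.** Let `B` be a separable stable C*-algebra (playing the role of
`A ⊗ K` for a separable C*-algebra `A`, realized nondegenerately on a Hilbert space).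
Every Cuntz-increasing sequence `(p_n)` of open projections in `B** = (A ⊗ K)**`
(i.e. `p_n ≾ p_{n+1}` for all `n`) admits a supremum of its classes `[p_n]` in
`Cu(A)`: there is an open projection `s` whose class is the least upper bound of the
classes `[p_n]` for the Cuntz order. -/
theorem sup_of_cuntz_increasing_sequence
    {H : Type*} [NormedAddCommGroup H] [InnerProductSpace ℂ H] [CompleteSpace H]
    (B : Set (H →L[ℂ] H)) (hB : IsCStarSubalg B)
    (hsep : TopologicalSpace.IsSeparable B) (hnd : Nondegenerate B)
    (hstable : IsStableAlg B)
    (p : ℕ → H →L[ℂ] H) (hopen : ∀ n, IsOpenProjection B (p n))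
    (hsub : ∀ n, CuLE B (p n) (p (n + 1))) :
    ∃ s : H →L[ℂ] H, IsOpenProjection B s ∧ (∀ n, CuLE B (p n) s) ∧
      ∀ r, IsOpenProjection B r → (∀ n, CuLE B (p n) r) → CuLE B s r :=
  main_aux B hB hsep hnd hstable p hopen hsub

end CuntzOP
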